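/- arXiv:0807.3313 — 6 statements merged into one kernel-verified Lean document; each statement's English description precedes it below -/
import Mathlib

section
/- For all s, t > 0, κ₂ > 0 and reals q ≤ r, the following Gaussian integral identity holds: ∫_r^∞ Φ_{κ₂s}(q−x)·Φ_{κ₂t}(r−x) dx + ∫_{−∞}^q (1 − Φ_{κ₂s}(q−x))·(1 − Φ_{κ₂t}(r−x)) dx − ∫_q^r Φ_{κ₂s}(q−x)·(1 − Φ_{κ₂t}(r−x)) dx = Ψ_{κ₂s}(r−q) + Ψ_{κ₂t}(r−q) − Ψ_{κ₂(t+s)}(r−q). (In the notation of the paper, Γ_0^{(2)}((s,q),(t,r)) = Γ_0((s,q),(t,r)).) -/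
open MeasureTheory Real Set

/-- The centered Gaussian density with variance `s`. -/
noncomputable def gphi (s x : ℝ) : ℝ :=
  (Real.sqrt (2 * Real.pi * s))⁻¹ * Real.exp (-(x ^ 2) / (2 * s))

/-- The centered Gaussian distribution function with variance `s`. -/
noncomputable def gPhi (s x : ℝ) : ℝ := ∫ y in Set.Iic x, gphi s y

/-- `Ψ_{σ²}(x) = σ²·φ_{σ²}(x) − x·(1 − Φ_{σ²}(x))`. -/
noncomputable def gPsi (s x : ℝ) : ℝ := s * gphi s x - x * (1 - gPhi s x)

open ProbabilityTheory Filter Topology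
open scoped NNReal MeasureTheory

lemma gaussianPDFReal_zero_eq_gphi (v : ℝ≥0) (x : ℝ) : gaussianPDFReal 0 v x = gphi v x := by
  simp [gaussianPDFReal, gphi]

lemma gPhi_eq_gaussianReal {v : ℝ≥0} (hv : v ≠ 0) (x : ℝ) :
    gPhi v x = (gaussianReal 0 v).real (Iic x) := by
  have h : 0 ≤ ∫ y in Iic x, gaussianPDFReal 0 v y :=
    integral_nonneg fun y ↦ gaussianPDFReal_nonneg 0 v y
  rw [measureReal_def, gaussianReal_apply_eq_integral 0 hv, ENNReal.toReal_ofReal h]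
  simp only [gaussianPDFReal_zero_eq_gphi, gPhi]

lemma one_sub_gPhi_eq_gaussianReal {v : ℝ≥0} (hv : v ≠ 0) (x : ℝ) :
    1 - gPhi v x = (gaussianReal 0 v).real (Ioi x) := by
  rw [gPhi_eq_gaussianReal hv, ← compl_Iic, probReal_compl_eq_one_sub measurableSet_Iic]

lemma gPhi_sub_eq_gaussianReal_Ici {v : ℝ≥0} (hv : v ≠ 0) (q x : ℝ) :
    gPhi v (q - x) = (gaussianReal q v).real (Ici x) := by
  have h := gaussianReal_map_const_sub (μ := 0) (v := v) q
  rw [sub_zero] at h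
  rw [← h, map_measureReal_apply (by fun_prop) measurableSet_Ici, gPhi_eq_gaussianReal hv]
  congr 1
  ext y
  simp only [mem_Iic, mem_preimage, mem_Ici]
  constructor <;> intro <;> linarith

lemma one_sub_gPhi_sub_eq_gaussianReal_Ioi {v : ℝ≥0} (hv : v ≠ 0) (r x : ℝ) :
    1 - gPhi v (r - x) = (gaussianReal (-r) v).real (Ioi (-x)) := by
  have h := gaussianReal_map_sub_const (μ := 0) (v := v) r
  rw [zero_sub] at h
  rw [← h, map_measureReal_apply (by fun_prop) measurableSet_Ioi, one_sub_gPhi_eq_gaussianReal hv]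
  congr 1
  ext y
  simp only [mem_Ioi, mem_preimage]
  constructor <;> intro <;> linarith

lemma hasDerivAt_mul_gphi {v : ℝ} (hv : v ≠ 0) (x : ℝ) :
    HasDerivAt (fun y ↦ -(v * gphi v y)) (x * gphi v x) x := by
  unfold gphi
  have h1 : HasDerivAt (fun y : ℝ ↦ -(y ^ 2) / (2 * v)) (-(2 * x) / (2 * v)) x := by
    simpa using ((hasDerivAt_pow 2 x).neg.div_const (2 * v))
  refine (((h1.exp).const_mul ((√(2 * π * v))⁻¹)).const_mul v).neg.congr_deriv ?_
  field_simp

lemma tendsto_gphi_atTop {v : ℝ} (hv : 0 < v) : Tendsto (gphi v) atTop (𝓝 0) := by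
  have h : Tendsto (fun x : ℝ ↦ -(x ^ 2) / (2 * v)) atTop atBot :=
    (tendsto_neg_atTop_atBot.comp (tendsto_pow_atTop two_ne_zero)).atBot_div_const (by positivity)
  rw [← mul_zero ((√(2 * π * v))⁻¹)]
  exact (Real.tendsto_exp_atBot.comp h).const_mul ((√(2 * π * v))⁻¹)

lemma integrable_gphi (v : ℝ≥0) : Integrable (gphi v) := by
  simpa only [funext (gaussianPDFReal_zero_eq_gphi v)] using integrable_gaussianPDFReal 0 v

lemma integrable_mul_gphi {v : ℝ≥0} (hv : v ≠ 0) : Integrable fun x ↦ x * gphi v x := by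
  have hv' : (0 : ℝ) < v := by positivity
  have h := (integrable_mul_exp_neg_mul_sq (b := 1 / (2 * (v : ℝ))) (by positivity)).const_mul
    ((√(2 * π * v))⁻¹)
  refine h.congr (ae_of_all _ fun x ↦ ?_)
  simp only [gphi]
  rw [show -(1 / (2 * (v : ℝ))) * x ^ 2 = -(x ^ 2) / (2 * v) by ring]
  ring

lemma integral_Ioi_mul_gphi {v : ℝ≥0} (hv : v ≠ 0) (a : ℝ) :
    ∫ x in Ioi a, x * gphi v x = v * gphi v a := by
  have hv' : (0 : ℝ) < v := by positivity
  have h := integral_Ioi_of_hasDerivAt_of_tendsto' (a := a)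
    (fun x _ ↦ hasDerivAt_mul_gphi hv'.ne' x) (integrable_mul_gphi hv).integrableOn
    ((tendsto_gphi_atTop hv').const_mul (v : ℝ)).neg
  simpa using h

lemma integral_Ioi_gphi {v : ℝ≥0} (hv : v ≠ 0) (a : ℝ) :
    ∫ x in Ioi a, gphi v x = 1 - gPhi v a := by
  have h1 : ∫ x, gphi v x = 1 := by
    simpa only [gaussianPDFReal_zero_eq_gphi] using integral_gaussianPDFReal_eq_one 0 hv
  have h := integral_add_compl (measurableSet_Iic (a := a)) (integrable_gphi v)
  rw [compl_Iic, h1] at h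
  rw [gPhi, ← h, add_sub_cancel_left]

lemma integral_posPart_gaussianReal {v : ℝ≥0} (hv : v ≠ 0) (m : ℝ) :
    ∫ x, max x 0 ∂gaussianReal m v = gPsi v (-m) := by
  have h := gaussianReal_map_add_const (μ := 0) (v := v) m
  rw [zero_add] at h
  rw [← h, integral_map (by fun_prop) (by fun_prop), integral_gaussianReal_eq_integral_smul hv]
  have h_eq : (fun x ↦ gaussianPDFReal 0 v x • max (x + m) 0)
      = (Ioi (-m)).indicator (fun x ↦ x * gphi v x + m * gphi v x) := by
    ext x
    rw [gaussianPDFReal_zero_eq_gphi, smul_eq_mul]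
    by_cases hx : x ∈ Ioi (-m)
    · rw [indicator_of_mem hx, max_eq_left (by rw [mem_Ioi] at hx; linarith)]
      ring
    · rw [indicator_of_notMem hx, max_eq_right (by rw [mem_Ioi] at hx; linarith), mul_zero]
  rw [h_eq, integral_indicator measurableSet_Ioi,
    integral_add (integrable_mul_gphi hv).integrableOn
      ((integrable_gphi v).const_mul m).integrableOn,
    integral_const_mul, integral_Ioi_mul_gphi hv, integral_Ioi_gphi hv, gPsi]
  ring

lemma lintegral_Ici_mul_Ioi_neg (μ ν : Measure ℝ) [SFinite μ] [SFinite ν] :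
    ∫⁻ x, μ (Ici x) * ν (Ioi (-x)) = ∫⁻ z, ENNReal.ofReal z ∂(μ ∗ ν) := by
  have h_le : MeasurableSet {p : ℝ × ℝ × ℝ | p.1 ≤ p.2.1} :=
    measurableSet_le (by fun_prop) (by fun_prop)
  have h_lt : MeasurableSet {p : ℝ × ℝ × ℝ | -p.1 < p.2.2} :=
    measurableSet_lt (by fun_prop) (by fun_prop)
  have hs : MeasurableSet {p : ℝ × ℝ × ℝ | p.1 ≤ p.2.1 ∧ -p.1 < p.2.2} := h_le.inter h_lt
  calc ∫⁻ x, μ (Ici x) * ν (Ioi (-x))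
      = ∫⁻ x, (μ.prod ν) (Prod.mk x ⁻¹' {p : ℝ × ℝ × ℝ | p.1 ≤ p.2.1 ∧ -p.1 < p.2.2}) := by
        refine lintegral_congr fun x ↦ ?_
        rw [← Measure.prod_prod]
        rfl
    _ = ∫⁻ p, volume ((fun x ↦ (x, p)) ⁻¹' {p : ℝ × ℝ × ℝ | p.1 ≤ p.2.1 ∧ -p.1 < p.2.2})
          ∂(μ.prod ν) := by
        rw [← Measure.prod_apply hs, Measure.prod_apply_symm hs]
    _ = ∫⁻ p, ENNReal.ofReal (p.1 + p.2) ∂(μ.prod ν) := by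
        refine lintegral_congr fun p ↦ ?_
        have : (fun x ↦ (x, p)) ⁻¹' {p : ℝ × ℝ × ℝ | p.1 ≤ p.2.1 ∧ -p.1 < p.2.2}
            = Ioc (-p.2) p.1 := by
          ext x
          simp only [mem_preimage, mem_ofPred_eq, mem_Ioc]
          rw [neg_lt, and_comm]
        rw [this, Real.volume_Ioc, sub_neg_eq_add]
    _ = ∫⁻ z, ENNReal.ofReal z ∂(μ ∗ ν) := by
        rw [Measure.conv, lintegral_map (by fun_prop) (by fun_prop)]

lemma lintegral_gaussianReal_Ici_mul_Ioi_neg {v w : ℝ≥0} (hvw : v + w ≠ 0) (q r : ℝ) :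
    ∫⁻ x, gaussianReal q v (Ici x) * gaussianReal (-r) w (Ioi (-x))
      = ENNReal.ofReal (gPsi (v + w) (r - q)) := by
  have h_int : Integrable (fun x : ℝ ↦ x) (gaussianReal (q + -r) (v + w)) :=
    (memLp_id_gaussianReal 1).integrable le_rfl
  rw [lintegral_Ici_mul_Ioi_neg, gaussianReal_conv_gaussianReal,
    show r - q = -(q + -r) by ring, ← NNReal.coe_add, ← integral_posPart_gaussianReal hvw,
    ofReal_integral_eq_lintegral_ofReal h_int.pos_part (ae_of_all _ fun x ↦ le_max_right _ _)]
  simp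

lemma gPsi_nonneg {v : ℝ≥0} (hv : v ≠ 0) (a : ℝ) : 0 ≤ gPsi v a := by
  rw [← neg_neg a, ← integral_posPart_gaussianReal hv]
  exact integral_nonneg fun x ↦ le_max_right _ _

lemma measurable_measure_Ici_mul_Ioi_neg (μ ν : Measure ℝ) :
    Measurable fun x ↦ μ (Ici x) * ν (Ioi (-x)) := by
  have hμ : Antitone fun x ↦ μ (Ici x) := fun _ _ h ↦ measure_mono (Ici_subset_Ici.2 h)
  have hν : Monotone fun x ↦ ν (Ioi (-x)) := fun _ _ h ↦
    measure_mono (Ioi_subset_Ioi (neg_le_neg h))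
  exact hμ.measurable.mul hν.measurable

lemma integrable_gaussianReal_Ici_mul_Ioi_neg {v w : ℝ≥0} (hvw : v + w ≠ 0) (q r : ℝ) :
    Integrable fun x ↦ (gaussianReal q v).real (Ici x) * (gaussianReal (-r) w).real (Ioi (-x)) := by
  simp only [measureReal_def, ← ENNReal.toReal_mul]
  refine integrable_toReal_of_lintegral_ne_top
    (measurable_measure_Ici_mul_Ioi_neg _ _).aemeasurable ?_
  rw [lintegral_gaussianReal_Ici_mul_Ioi_neg hvw]
  exact ENNReal.ofReal_ne_top

lemma integral_gaussianReal_Ici_mul_Ioi_neg {v w : ℝ≥0} (hvw : v + w ≠ 0) (q r : ℝ) :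
    ∫ x, (gaussianReal q v).real (Ici x) * (gaussianReal (-r) w).real (Ioi (-x))
      = gPsi (v + w) (r - q) := by
  simp only [measureReal_def, ← ENNReal.toReal_mul]
  rw [integral_toReal (measurable_measure_Ici_mul_Ioi_neg _ _).aemeasurable
      (ae_of_all _ fun x ↦ ENNReal.mul_lt_top (measure_lt_top _ _) (measure_lt_top _ _)),
    lintegral_gaussianReal_Ici_mul_Ioi_neg hvw, ENNReal.toReal_ofReal]
  exact_mod_cast gPsi_nonneg hvw (r - q)

lemma dirac_real_Ici_mul (q : ℝ) (f : ℝ → ℝ) (x : ℝ) :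
    (Measure.dirac q).real (Ici x) * f x = (Iic q).indicator f x := by
  by_cases hx : x ≤ q <;> simp [measureReal_def, hx]

lemma mul_dirac_real_Ioi_neg (r : ℝ) (f : ℝ → ℝ) (x : ℝ) :
    f x * (Measure.dirac (-r)).real (Ioi (-x)) = (Ioi r).indicator f x := by
  by_cases hx : r < x <;> simp [measureReal_def, hx]

lemma integrableOn_Ioi_gaussianReal_Ici {v : ℝ≥0} (hv : v ≠ 0) (q r : ℝ) :
    IntegrableOn (fun x ↦ (gaussianReal q v).real (Ici x)) (Ioi r) := by
  have h := integrable_gaussianReal_Ici_mul_Ioi_neg (v := v) (w := 0) (by simpa) q r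
  simp only [gaussianReal_zero_var,
    mul_dirac_real_Ioi_neg r fun x ↦ (gaussianReal q v).real (Ici x)] at h
  exact (integrable_indicator_iff measurableSet_Ioi).1 h

lemma integral_Ioi_gaussianReal_Ici {v : ℝ≥0} (hv : v ≠ 0) (q r : ℝ) :
    ∫ x in Ioi r, (gaussianReal q v).real (Ici x) = gPsi v (r - q) := by
  have h := integral_gaussianReal_Ici_mul_Ioi_neg (v := v) (w := 0) (by simpa) q r
  simp only [gaussianReal_zero_var,
    mul_dirac_real_Ioi_neg r fun x ↦ (gaussianReal q v).real (Ici x),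
    NNReal.coe_zero, add_zero] at h
  rwa [integral_indicator measurableSet_Ioi] at h

lemma integrableOn_Iic_gaussianReal_Ioi_neg {w : ℝ≥0} (hw : w ≠ 0) (q r : ℝ) :
    IntegrableOn (fun x ↦ (gaussianReal (-r) w).real (Ioi (-x))) (Iic q) := by
  have h := integrable_gaussianReal_Ici_mul_Ioi_neg (v := 0) (w := w) (by simpa) q r
  simp only [gaussianReal_zero_var,
    dirac_real_Ici_mul q fun x ↦ (gaussianReal (-r) w).real (Ioi (-x))] at h
  exact (integrable_indicator_iff measurableSet_Iic).1 h

lemma integral_Iic_gaussianReal_Ioi_neg {w : ℝ≥0} (hw : w ≠ 0) (q r : ℝ) :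
    ∫ x in Iic q, (gaussianReal (-r) w).real (Ioi (-x)) = gPsi w (r - q) := by
  have h := integral_gaussianReal_Ici_mul_Ioi_neg (v := 0) (w := w) (by simpa) q r
  simp only [gaussianReal_zero_var,
    dirac_real_Ici_mul q fun x ↦ (gaussianReal (-r) w).real (Ioi (-x)),
    NNReal.coe_zero, zero_add] at h
  rwa [integral_indicator measurableSet_Iic] at h

/-- the Gaussian integral identity `Γ_0^{(2)}((s,q),(t,r)) = Γ_0((s,q),(t,r))`. -/
theorem gamma0_identity (κ₂ s t q r : ℝ) (hκ : 0 < κ₂) (hs : 0 < s) (ht : 0 < t)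
    (hqr : q ≤ r) :
    (∫ x in Set.Ioi r, gPhi (κ₂ * s) (q - x) * gPhi (κ₂ * t) (r - x))
      + (∫ x in Set.Iic q, (1 - gPhi (κ₂ * s) (q - x)) * (1 - gPhi (κ₂ * t) (r - x)))
      - (∫ x in Set.Ioc q r, gPhi (κ₂ * s) (q - x) * (1 - gPhi (κ₂ * t) (r - x)))
    = gPsi (κ₂ * s) (r - q) + gPsi (κ₂ * t) (r - q) - gPsi (κ₂ * (t + s)) (r - q) := by
  rw [mul_add, add_comm (κ₂ * t)]
  have hv : 0 < κ₂ * s := mul_pos hκ hs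
  have hw : 0 < κ₂ * t := mul_pos hκ ht
  generalize κ₂ * s = v at *
  generalize κ₂ * t = w at *
  lift v to ℝ≥0 using hv.le
  lift w to ℝ≥0 using hw.le
  replace hv : v ≠ 0 := by exact_mod_cast hv.ne'
  replace hw : w ≠ 0 := by exact_mod_cast hw.ne'
  have hvw : v + w ≠ 0 := by simp [hv]
  set F : ℝ → ℝ := fun x ↦ gPhi v (q - x) with hF
  set G : ℝ → ℝ := fun x ↦ 1 - gPhi w (r - x) with hG
  have hF' : F = fun x ↦ (gaussianReal q v).real (Ici x) :=
    funext fun x ↦ gPhi_sub_eq_gaussianReal_Ici hv q x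
  have hG' : G = fun x ↦ (gaussianReal (-r) w).real (Ioi (-x)) :=
    funext fun x ↦ one_sub_gPhi_sub_eq_gaussianReal_Ioi hw r x
  have hF_int : IntegrableOn F (Ioi r) := hF' ▸ integrableOn_Ioi_gaussianReal_Ici hv q r
  have hG_int : IntegrableOn G (Iic q) := hG' ▸ integrableOn_Iic_gaussianReal_Ioi_neg hw q r
  have hFG_int : Integrable fun x ↦ F x * G x := by
    simpa only [hF', hG'] using integrable_gaussianReal_Ici_mul_Ioi_neg hvw q r
  have hF_val : ∫ x in Ioi r, F x = gPsi v (r - q) := by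
    simpa only [hF'] using integral_Ioi_gaussianReal_Ici hv q r
  have hG_val : ∫ x in Iic q, G x = gPsi w (r - q) := by
    simpa only [hG'] using integral_Iic_gaussianReal_Ioi_neg hw q r
  have hFG_val : ∫ x, F x * G x = gPsi (v + w) (r - q) := by
    simpa only [hF', hG'] using integral_gaussianReal_Ici_mul_Ioi_neg hvw q r
  have h_Ioi : ∫ x in Ioi r, gPhi v (q - x) * gPhi w (r - x)
      = gPsi v (r - q) - ∫ x in Ioi r, F x * G x := by
    rw [← hF_val, ← integral_sub hF_int hFG_int.integrableOn]
    congr 1 with x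
    simp only [hF, hG]
    ring
  have h_Iic : ∫ x in Iic q, (1 - gPhi v (q - x)) * (1 - gPhi w (r - x))
      = gPsi w (r - q) - ∫ x in Iic q, F x * G x := by
    rw [← hG_val, ← integral_sub hG_int hFG_int.integrableOn]
    congr 1 with x
    simp only [hF, hG]
    ring
  have h_split : ∫ x, F x * G x = (∫ x in Iic q, F x * G x) + (∫ x in Ioc q r, F x * G x)
      + ∫ x in Ioi r, F x * G x := by
    rw [← setIntegral_union (Iic_disjoint_Ioc le_rfl) measurableSet_Ioc hFG_int.integrableOn
        hFG_int.integrableOn, Iic_union_Ioc_eq_Iic hqr, ← compl_Iic,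
      integral_add_compl measurableSet_Iic hFG_int]
  rw [h_Ioi, h_Iic, ← hFG_val, h_split]
  ring
end

section
/- (Tightness criterion for two-parameter processes.) Suppose {X_n} is a sequence of two-parameter stochastic processes on [0,1]² satisfying: for every n there exists δ_n > 0 such that (1) there exist β > 0, σ > 2 and C > 0 such that for all n sufficiently large, E[ |X_n(s,q) − X_n(t,r)|^β ] ≤ C·|(s,q) − (t,r)|^σ for all s,t,q,r ∈ [0,1] with |(s,q) − (t,r)| > δ_n; and (2) for every ε > 0 and η > 0 there exists n₀ such that P( w_{X_n}(δ_n) > ε ) < η for all n ≥ n₀. Then for every ε > 0 and η > 0 there exist δ ∈ (0,1) and an integer n₀ such that P( w_{X_n}(δ) ≥ ε ) ≤ η for all n ≥ n₀. -/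
open MeasureTheory Real Set
open scoped ENNReal

/-- The modulus of continuity of a two-parameter function on `[0,1]²` (Euclidean distance),
with values in `ℝ≥0∞`. -/
noncomputable def modulus (h : ℝ → ℝ → ℝ) (δ : ℝ) : ℝ≥0∞ :=
  ⨆ x : {x : (ℝ × ℝ) × (ℝ × ℝ) //
      x.1.1 ∈ Set.Icc (0:ℝ) 1 ∧ x.1.2 ∈ Set.Icc (0:ℝ) 1 ∧
      x.2.1 ∈ Set.Icc (0:ℝ) 1 ∧ x.2.2 ∈ Set.Icc (0:ℝ) 1 ∧
      Real.sqrt ((x.1.1 - x.2.1) ^ 2 + (x.1.2 - x.2.2) ^ 2) < δ},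
    ENNReal.ofReal |h x.1.1.1 x.1.1.2 - h x.1.2.1 x.1.2.2|

/-- The increments of `f` between neighbouring points of the dyadic grid of mesh `2⁻ᵏ` in the unit
square are at most `a`. -/
def GridIncrementsLE (f : ℝ → ℝ → ℝ) (k : ℕ) (a : ℝ) : Prop :=
  ∀ i j : ℕ, i < 2 ^ k → j ≤ 2 ^ k →
    |f (((i + 1 : ℕ) : ℝ) / 2 ^ k) ((j : ℝ) / 2 ^ k) - f ((i : ℝ) / 2 ^ k) ((j : ℝ) / 2 ^ k)| ≤ a ∧
    |f ((j : ℝ) / 2 ^ k) (((i + 1 : ℕ) : ℝ) / 2 ^ k) - f ((j : ℝ) / 2 ^ k) ((i : ℝ) / 2 ^ k)| ≤ a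

theorem GridIncrementsLE.abs_sub_le {f : ℝ → ℝ → ℝ} {k : ℕ} {a : ℝ} (h : GridIncrementsLE f k a)
    (ha : 0 ≤ a) {i i' j j' : ℕ} (hi : i ≤ 2 ^ k) (hi' : i' ≤ 2 ^ k) (hj : j ≤ 2 ^ k)
    (hj' : j' ≤ 2 ^ k) (h₁ : i ≤ i' + 1) (h₂ : i' ≤ i + 1) (h₃ : j ≤ j' + 1) (h₄ : j' ≤ j + 1) :
    |f ((i : ℝ) / 2 ^ k) ((j : ℝ) / 2 ^ k) - f ((i' : ℝ) / 2 ^ k) ((j' : ℝ) / 2 ^ k)| ≤ 2 * a := by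
  have hfst : |f ((i : ℝ) / 2 ^ k) ((j : ℝ) / 2 ^ k) - f ((i' : ℝ) / 2 ^ k) ((j : ℝ) / 2 ^ k)|
      ≤ a := by
    rcases (by omega : i = i' ∨ i = i' + 1 ∨ i' = i + 1) with rfl | rfl | rfl
    · simpa using ha
    · exact (h i' j (by omega) hj).1
    · rw [abs_sub_comm]
      exact (h i j (by omega) hj).1
  have hsnd : |f ((i' : ℝ) / 2 ^ k) ((j : ℝ) / 2 ^ k) - f ((i' : ℝ) / 2 ^ k) ((j' : ℝ) / 2 ^ k)|
      ≤ a := by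
    rcases (by omega : j = j' ∨ j = j' + 1 ∨ j' = j + 1) with rfl | rfl | rfl
    · simpa using ha
    · exact (h j' i' (by omega) hi').2
    · rw [abs_sub_comm]
      exact (h j i' (by omega) hi').2
  linarith [_root_.abs_sub_le (f ((i : ℝ) / 2 ^ k) ((j : ℝ) / 2 ^ k))
    (f ((i' : ℝ) / 2 ^ k) ((j : ℝ) / 2 ^ k)) (f ((i' : ℝ) / 2 ^ k) ((j' : ℝ) / 2 ^ k))]

/-- The largest multiple of `2⁻ᵏ` below `x`. -/
noncomputable def dyadicFloor (k : ℕ) (x : ℝ) : ℝ := (⌊2 ^ k * x⌋₊ : ℝ) / 2 ^ k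

theorem floor_two_pow_mul_le {k : ℕ} {x : ℝ} (hx : x ∈ Icc (0 : ℝ) 1) : ⌊2 ^ k * x⌋₊ ≤ 2 ^ k := by
  have : (2 : ℝ) ^ k * x ≤ ((2 ^ k : ℕ) : ℝ) := by
    push_cast
    exact mul_le_of_le_one_right (by positivity) hx.2
  exact (Nat.floor_le_floor this).trans_eq (Nat.floor_natCast _)

theorem dyadicFloor_nonneg (k : ℕ) (x : ℝ) : 0 ≤ dyadicFloor k x := by
  unfold dyadicFloor; positivity

theorem dyadicFloor_le {k : ℕ} {x : ℝ} (hx : 0 ≤ x) : dyadicFloor k x ≤ x := by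
  rw [dyadicFloor, div_le_iff₀ (by positivity), mul_comm x]
  exact Nat.floor_le (by positivity)

theorem lt_dyadicFloor_add (k : ℕ) (x : ℝ) : x < dyadicFloor k x + (1 / 2) ^ k := by
  have h := Nat.lt_floor_add_one ((2 : ℝ) ^ k * x)
  rw [dyadicFloor, one_div, inv_pow, ← one_div, ← add_div, lt_div_iff₀ (by positivity), mul_comm]
  exact h

theorem floor_le_floor_add_one {k : ℕ} {x y : ℝ} (hy : 0 ≤ y) (h : x - y < (1 / 2) ^ k) :
    ⌊2 ^ k * x⌋₊ ≤ ⌊2 ^ k * y⌋₊ + 1 := by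
  rw [← Nat.floor_add_one (by positivity)]
  apply Nat.floor_le_floor
  have : (2 : ℝ) ^ k * (x - y) ≤ 2 ^ k * (1 / 2) ^ k := by gcongr
  rw [← mul_pow] at this
  norm_num at this
  linarith

theorem floor_two_pow_succ_mul {k : ℕ} {x : ℝ} (hx : 0 ≤ x) :
    2 * ⌊2 ^ k * x⌋₊ ≤ ⌊2 ^ (k + 1) * x⌋₊ ∧ ⌊2 ^ (k + 1) * x⌋₊ ≤ 2 * ⌊2 ^ k * x⌋₊ + 1 := by
  have h₁ := Nat.floor_le (show 0 ≤ (2 : ℝ) ^ k * x by positivity)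
  have h₂ := Nat.lt_floor_add_one ((2 : ℝ) ^ k * x)
  constructor
  · apply Nat.le_floor
    push_cast
    rw [pow_succ]
    linarith
  · rw [← Nat.lt_succ_iff, Nat.floor_lt (by positivity)]
    push_cast
    rw [pow_succ]
    linarith

theorem dyadicFloor_eq_succ (k : ℕ) (x : ℝ) :
    dyadicFloor k x = ((2 * ⌊2 ^ k * x⌋₊ : ℕ) : ℝ) / 2 ^ (k + 1) := by
  rw [dyadicFloor, pow_succ]
  push_cast
  field_simp

theorem abs_sub_dyadicFloor_le {f : ℝ → ℝ → ℝ} {a : ℕ → ℝ} (ha : ∀ k, 0 ≤ a k) {m K : ℕ}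
    (hmK : m ≤ K) (hf : ∀ k, m ≤ k → k ≤ K → GridIncrementsLE f k (a k)) {s q : ℝ}
    (hs : s ∈ Icc (0 : ℝ) 1) (hq : q ∈ Icc (0 : ℝ) 1) :
    |f (dyadicFloor K s) (dyadicFloor K q) - f (dyadicFloor m s) (dyadicFloor m q)| ≤
      2 * ∑ k ∈ Finset.Ico m K, a (k + 1) := by
  induction K, hmK using Nat.le_induction with
  | base => simp
  | succ K hmK ih =>
    have ih := ih fun k h₁ h₂ => hf k h₁ (h₂.trans K.le_succ)
    rw [Finset.sum_Ico_succ_top hmK]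
    have hstep : |f (dyadicFloor (K + 1) s) (dyadicFloor (K + 1) q) -
        f (dyadicFloor K s) (dyadicFloor K q)| ≤ 2 * a (K + 1) := by
      rw [dyadicFloor_eq_succ K s, dyadicFloor_eq_succ K q]
      have hs' := floor_two_pow_succ_mul (k := K) hs.1
      have hq' := floor_two_pow_succ_mul (k := K) hq.1
      have hsK := floor_two_pow_mul_le (k := K + 1) hs
      have hqK := floor_two_pow_mul_le (k := K + 1) hq
      exact (hf (K + 1) (by omega) le_rfl).abs_sub_le (ha _) hsK (by omega) hqK (by omega)
        (by omega) (by omega) (by omega) (by omega)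
    linarith [abs_sub_le (f (dyadicFloor (K + 1) s) (dyadicFloor (K + 1) q))
      (f (dyadicFloor K s) (dyadicFloor K q)) (f (dyadicFloor m s) (dyadicFloor m q))]

theorem modulus_mono (f : ℝ → ℝ → ℝ) {δ δ' : ℝ} (h : δ ≤ δ') : modulus f δ ≤ modulus f δ' :=
  iSup_le fun ⟨x, h₁, h₂, h₃, h₄, h₅⟩ => le_iSup_of_le ⟨x, h₁, h₂, h₃, h₄, h₅.trans_le h⟩ le_rfl

theorem abs_sub_le_of_modulus_le {f : ℝ → ℝ → ℝ} {δ e : ℝ} (he : 0 ≤ e)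
    (h : modulus f δ ≤ ENNReal.ofReal e) {s q t r : ℝ} (hs : s ∈ Icc (0 : ℝ) 1)
    (hq : q ∈ Icc (0 : ℝ) 1) (ht : t ∈ Icc (0 : ℝ) 1) (hr : r ∈ Icc (0 : ℝ) 1)
    (hd : √((s - t) ^ 2 + (q - r) ^ 2) < δ) : |f s q - f t r| ≤ e := by
  rw [← ENNReal.ofReal_le_ofReal_iff he]
  exact (le_iSup_of_le ⟨((s, q), (t, r)), hs, hq, ht, hr, hd⟩ le_rfl).trans h

theorem abs_sub_le_four_mul_of_modulus_le {f : ℝ → ℝ → ℝ} {δ e : ℝ} (he : 0 ≤ e)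
    (h : modulus f δ ≤ ENNReal.ofReal e) {s q t r : ℝ} (hs : s ∈ Icc (0 : ℝ) 1)
    (hq : q ∈ Icc (0 : ℝ) 1) (ht : t ∈ Icc (0 : ℝ) 1) (hr : r ∈ Icc (0 : ℝ) 1)
    (hst : |s - t| < 2 * δ) (hqr : |q - r| < 2 * δ) : |f s q - f t r| ≤ 4 * e := by
  have hmid : ∀ {x y : ℝ}, x ∈ Icc (0 : ℝ) 1 → y ∈ Icc (0 : ℝ) 1 → (x + y) / 2 ∈ Icc (0 : ℝ) 1 :=
    fun hx hy => ⟨by linarith [hx.1, hy.1], by linarith [hx.2, hy.2]⟩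
  have hu := hmid hs ht
  have hv := hmid hq hr
  rw [abs_lt] at hst hqr
  have hsqrt : ∀ x : ℝ, -(2 * δ) < 2 * x → 2 * x < 2 * δ → √(x ^ 2) < δ := fun x h₁ h₂ => by
    rw [Real.sqrt_sq_eq_abs, abs_lt]
    constructor <;> linarith
  have e₁ : |f s q - f ((s + t) / 2) q| ≤ e := by
    refine abs_sub_le_of_modulus_le he h hs hq hu hq ?_
    simpa using hsqrt (s - (s + t) / 2) (by linarith) (by linarith)
  have e₂ : |f ((s + t) / 2) q - f t q| ≤ e := by
    refine abs_sub_le_of_modulus_le he h hu hq ht hq ?_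
    simpa using hsqrt ((s + t) / 2 - t) (by linarith) (by linarith)
  have e₃ : |f t q - f t ((q + r) / 2)| ≤ e := by
    refine abs_sub_le_of_modulus_le he h ht hq ht hv ?_
    simpa using hsqrt (q - (q + r) / 2) (by linarith) (by linarith)
  have e₄ : |f t ((q + r) / 2) - f t r| ≤ e := by
    refine abs_sub_le_of_modulus_le he h ht hv ht hr ?_
    simpa using hsqrt ((q + r) / 2 - r) (by linarith) (by linarith)
  rw [abs_le] at *
  constructor <;> linarith [e₁.1, e₁.2, e₂.1, e₂.2, e₃.1, e₃.2, e₄.1, e₄.2]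

/-- Chaining along the dyadic grids of mesh `2⁻ᵐ, …, 2⁻ᴷ`, where `2⁻ᴷ ≤ 2 δ`. -/
theorem modulus_le_of_gridIncrementsLE {f : ℝ → ℝ → ℝ} {a : ℕ → ℝ} (ha : ∀ k, 0 ≤ a k) {m K : ℕ}
    (hmK : m ≤ K) (hf : ∀ k, m ≤ k → k ≤ K → GridIncrementsLE f k (a k)) {δ e : ℝ} (he : 0 ≤ e)
    (hδ : (1 / 2) ^ K ≤ 2 * δ) (h : modulus f δ ≤ ENNReal.ofReal e) :
    modulus f ((1 / 2) ^ m) ≤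
      ENNReal.ofReal (8 * e + 4 * (∑ k ∈ Finset.Ico m K, a (k + 1)) + 2 * a m) := by
  have happrox : ∀ s ∈ Icc (0 : ℝ) 1, ∀ q ∈ Icc (0 : ℝ) 1,
      |f s q - f (dyadicFloor K s) (dyadicFloor K q)| ≤ 4 * e := by
    intro s hs q hq
    have hmem : ∀ x ∈ Icc (0 : ℝ) 1, dyadicFloor K x ∈ Icc (0 : ℝ) 1 := fun x hx =>
      ⟨dyadicFloor_nonneg K x, (dyadicFloor_le hx.1).trans hx.2⟩
    have hlt : ∀ x ∈ Icc (0 : ℝ) 1, |x - dyadicFloor K x| < 2 * δ := fun x hx => by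
      rw [abs_of_nonneg (sub_nonneg.2 (dyadicFloor_le hx.1))]
      linarith [lt_dyadicFloor_add K x]
    exact abs_sub_le_four_mul_of_modulus_le he h hs hq (hmem s hs) (hmem q hq) (hlt s hs)
      (hlt q hq)
  refine iSup_le ?_
  rintro ⟨⟨⟨s, q⟩, ⟨t, r⟩⟩, hs, hq, ht, hr, hd⟩
  dsimp only at hs hq ht hr hd ⊢
  apply ENNReal.ofReal_le_ofReal
  have hst : |s - t| < (1 / 2) ^ m := by
    refine lt_of_le_of_lt ?_ hd
    rw [← Real.sqrt_sq_eq_abs]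
    exact Real.sqrt_le_sqrt (by linarith [sq_nonneg (q - r)])
  have hqr : |q - r| < (1 / 2) ^ m := by
    refine lt_of_le_of_lt ?_ hd
    rw [← Real.sqrt_sq_eq_abs]
    exact Real.sqrt_le_sqrt (by linarith [sq_nonneg (s - t)])
  rw [abs_lt] at hst hqr
  have hcoarse : |f (dyadicFloor m s) (dyadicFloor m q) -
      f (dyadicFloor m t) (dyadicFloor m r)| ≤ 2 * a m :=
    (hf m le_rfl hmK).abs_sub_le (ha m) (floor_two_pow_mul_le hs) (floor_two_pow_mul_le ht)
      (floor_two_pow_mul_le hq) (floor_two_pow_mul_le hr)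
      (floor_le_floor_add_one ht.1 hst.2) (floor_le_floor_add_one hs.1 (by linarith))
      (floor_le_floor_add_one hr.1 hqr.2) (floor_le_floor_add_one hq.1 (by linarith))
  have hx := happrox s hs q hq
  have hy := happrox t ht r hr
  have hx' := abs_sub_dyadicFloor_le ha hmK hf hs hq
  have hy' := abs_sub_dyadicFloor_le ha hmK hf ht hr
  rw [abs_le] at *
  constructor <;>
    linarith [hx.1, hx.2, hy.1, hy.2, hx'.1, hx'.2, hy'.1, hy'.2, hcoarse.1, hcoarse.2]

theorem measure_lt_abs_le_of_lintegral_rpow_le {Ω : Type*} [MeasurableSpace Ω] {μ : Measure Ω}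
    {Y : Ω → ℝ} (hY : Measurable Y) {β a M : ℝ} (hβ : 0 < β) (ha : 0 < a)
    (h : ∫⁻ ω, ENNReal.ofReal (|Y ω| ^ β) ∂μ ≤ ENNReal.ofReal M) :
    μ {ω | a < |Y ω|} ≤ ENNReal.ofReal (M / a ^ β) := by
  have hpos : 0 < a ^ β := Real.rpow_pos_of_pos ha β
  calc μ {ω | a < |Y ω|}
      ≤ μ {ω | ENNReal.ofReal (a ^ β) ≤ ENNReal.ofReal (|Y ω| ^ β)} :=
        measure_mono fun ω (hω : a < |Y ω|) =>
          ENNReal.ofReal_le_ofReal (Real.rpow_le_rpow ha.le hω.le hβ.le)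
    _ ≤ (∫⁻ ω, ENNReal.ofReal (|Y ω| ^ β) ∂μ) / ENNReal.ofReal (a ^ β) :=
        meas_ge_le_lintegral_div (by fun_prop) (by simpa using hpos) ENNReal.ofReal_ne_top
    _ ≤ ENNReal.ofReal M / ENNReal.ofReal (a ^ β) := by gcongr
    _ = ENNReal.ofReal (M / a ^ β) := (ENNReal.ofReal_div_of_pos hpos).symm

theorem measure_not_gridIncrementsLE_le {Ω : Type*} [MeasurableSpace Ω] {μ : Measure Ω}
    {X : Ω → ℝ → ℝ → ℝ} (hX : ∀ s q, Measurable fun ω => X ω s q) {β σ C δ : ℝ} (hβ : 0 < β)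
    (hC : 0 < C)
    (h : ∀ s t q r : ℝ, s ∈ Icc (0 : ℝ) 1 → t ∈ Icc (0 : ℝ) 1 → q ∈ Icc (0 : ℝ) 1 →
      r ∈ Icc (0 : ℝ) 1 → δ < √((s - t) ^ 2 + (q - r) ^ 2) →
      ∫⁻ ω, ENNReal.ofReal (|X ω s q - X ω t r| ^ β) ∂μ ≤
        ENNReal.ofReal (C * √((s - t) ^ 2 + (q - r) ^ 2) ^ σ))
    {k : ℕ} (hk : δ < (1 / 2) ^ k) {a : ℝ} (ha : 0 < a) :
    μ {ω | ¬ GridIncrementsLE (X ω) k a} ≤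
      ENNReal.ofReal (4 * C * (4 ^ k * ((1 / 2) ^ k) ^ σ / a ^ β)) := by
  set b : ℝ := C * ((1 / 2) ^ k) ^ σ / a ^ β with hb
  have hb0 : 0 ≤ b := by positivity
  let E : ℕ × ℕ → Set Ω := fun p =>
    {ω | a < |X ω (((p.1 + 1 : ℕ) : ℝ) / 2 ^ k) ((p.2 : ℝ) / 2 ^ k) -
      X ω ((p.1 : ℝ) / 2 ^ k) ((p.2 : ℝ) / 2 ^ k)|} ∪
    {ω | a < |X ω ((p.2 : ℝ) / 2 ^ k) (((p.1 + 1 : ℕ) : ℝ) / 2 ^ k) -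
      X ω ((p.2 : ℝ) / 2 ^ k) ((p.1 : ℝ) / 2 ^ k)|}
  let I := Finset.range (2 ^ k) ×ˢ Finset.range (2 ^ k + 1)
  have hmem : ∀ i : ℕ, i ≤ 2 ^ k → (i : ℝ) / 2 ^ k ∈ Icc (0 : ℝ) 1 := fun i hi =>
    ⟨by positivity, div_le_one_of_le₀ (by exact_mod_cast hi) (by positivity)⟩
  have hdiff : ∀ i : ℕ, ((i + 1 : ℕ) : ℝ) / 2 ^ k - (i : ℝ) / 2 ^ k = (1 / 2) ^ k := fun i => by
    rw [← sub_div, one_div, inv_pow]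
    push_cast
    ring
  have hE : ∀ p ∈ I, μ (E p) ≤ ENNReal.ofReal (2 * b) := by
    rintro ⟨i, j⟩ hp
    simp only [I, Finset.mem_product, Finset.mem_range] at hp
    have hi := hmem i (by omega)
    have hi' := hmem (i + 1) (by omega)
    have hj := hmem j (by omega)
    have hsqrt : √(((1 / 2 : ℝ) ^ k) ^ 2) = (1 / 2) ^ k := Real.sqrt_sq (by positivity)
    have h₁ := h _ _ _ _ hi' hi hj hj
    have h₂ := h _ _ _ _ hj hj hi' hi
    rw [hdiff, sub_self, zero_pow two_ne_zero, add_zero, hsqrt] at h₁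
    rw [hdiff, sub_self, zero_pow two_ne_zero, zero_add, hsqrt] at h₂
    rw [two_mul, ENNReal.ofReal_add hb0 hb0]
    exact (measure_union_le _ _).trans (add_le_add
      (measure_lt_abs_le_of_lintegral_rpow_le ((hX _ _).sub (hX _ _)) hβ ha (h₁ hk))
      (measure_lt_abs_le_of_lintegral_rpow_le ((hX _ _).sub (hX _ _)) hβ ha (h₂ hk)))
  have hsub : {ω | ¬ GridIncrementsLE (X ω) k a} ⊆ ⋃ p ∈ I, E p := by
    intro ω hω
    contrapose! hω
    simp only [mem_iUnion, not_exists] at hω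
    rw [mem_ofPred_eq, not_not]
    intro i j hi hj
    have := hω (i, j) (by simp only [I, Finset.mem_product, Finset.mem_range]; omega)
    simpa only [E, mem_union, mem_ofPred_eq, not_or, not_lt] using this
  calc μ {ω | ¬ GridIncrementsLE (X ω) k a}
      ≤ ∑ p ∈ I, μ (E p) := (measure_mono hsub).trans (measure_biUnion_finset_le _ _)
    _ ≤ ∑ _p ∈ I, ENNReal.ofReal (2 * b) := Finset.sum_le_sum hE
    _ = ENNReal.ofReal ((2 ^ k * (2 ^ k + 1)) * (2 * b)) := by
        rw [Finset.sum_const, nsmul_eq_mul, Finset.card_product, Finset.card_range,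
          Finset.card_range, ← ENNReal.ofReal_natCast, ← ENNReal.ofReal_mul (by positivity)]
        push_cast
        rfl
    _ ≤ ENNReal.ofReal (4 * C * (4 ^ k * ((1 / 2) ^ k) ^ σ / a ^ β)) := by
        apply ENNReal.ofReal_le_ofReal
        have h4 : (4 : ℝ) ^ k = 2 ^ k * 2 ^ k := by rw [← mul_pow]; norm_num
        have h2 : (1 : ℝ) ≤ 2 ^ k := one_le_pow₀ (by norm_num)
        calc (2 ^ k * (2 ^ k + 1)) * (2 * b) ≤ (2 ^ k * (2 ^ k + 2 ^ k)) * (2 * b) := by gcongr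
          _ = 4 * C * (4 ^ k * ((1 / 2) ^ k) ^ σ / a ^ β) := by rw [h4, hb]; ring

theorem exists_geometric_ratios {β σ : ℝ} (hβ : 0 < β) (hσ : 2 < σ) :
    ∃ θ ρ : ℝ, 0 < θ ∧ θ < 1 ∧ 0 < ρ ∧ ρ < 1 ∧
      ∀ k : ℕ, 4 ^ k * ((1 / 2 : ℝ) ^ k) ^ σ / (θ ^ k) ^ β = ρ ^ k := by
  have h2 : (0 : ℝ) < 2 := two_pos
  refine ⟨2 ^ (-((σ - 2) / (2 * β))), 2 ^ (-((σ - 2) / 2)), by positivity,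
    Real.rpow_lt_one_of_one_lt_of_neg one_lt_two ?_, by positivity,
    Real.rpow_lt_one_of_one_lt_of_neg one_lt_two (by linarith), fun k => ?_⟩
  · have : 0 < (σ - 2) / (2 * β) := div_pos (by linarith) (by linarith)
    linarith
  · have h4 : (4 : ℝ) = 2 ^ (2 : ℝ) := by norm_num
    have hhalf : (1 / 2 : ℝ) = 2 ^ (-1 : ℝ) := by rw [Real.rpow_neg_one]; norm_num
    rw [h4, hhalf]
    simp only [← Real.rpow_natCast, ← Real.rpow_mul h2.le]
    rw [← Real.rpow_add h2, ← Real.rpow_sub h2]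
    congr 1
    field_simp
    ring

/-- tightness criterion for two-parameter processes on `[0,1]²`. -/
theorem tightness_criterion (Ω : ℕ → Type) (instM : ∀ n, MeasureSpace (Ω n))
    (hP : ∀ n, IsProbabilityMeasure (volume : Measure (Ω n)))
    (X : ∀ n, Ω n → ℝ → ℝ → ℝ)
    (hjm : ∀ n, Measurable fun p : Ω n × (ℝ × ℝ) => X n p.1 p.2.1 p.2.2)
    (hwm : ∀ n δ, Measurable fun ω => modulus (X n ω) δ)
    (δseq : ℕ → ℝ) (hδ : ∀ n, 0 < δseq n)
    (h1 : ∃ β > (0:ℝ), ∃ σ > (2:ℝ), ∃ C > (0:ℝ), ∃ N : ℕ, ∀ n ≥ N,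
      ∀ s t q r : ℝ, s ∈ Set.Icc (0:ℝ) 1 → t ∈ Set.Icc (0:ℝ) 1 →
        q ∈ Set.Icc (0:ℝ) 1 → r ∈ Set.Icc (0:ℝ) 1 →
        δseq n < Real.sqrt ((s - t) ^ 2 + (q - r) ^ 2) →
        (∫⁻ ω, ENNReal.ofReal (|X n ω s q - X n ω t r| ^ β))
          ≤ ENNReal.ofReal (C * Real.sqrt ((s - t) ^ 2 + (q - r) ^ 2) ^ σ))
    (h2 : ∀ ε > (0:ℝ), ∀ η > (0:ℝ), ∃ n₀ : ℕ, ∀ n ≥ n₀,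
      (volume {ω : Ω n | ENNReal.ofReal ε < modulus (X n ω) (δseq n)})
        < ENNReal.ofReal η) :
    ∀ ε > (0:ℝ), ∀ η > (0:ℝ), ∃ δ : ℝ, 0 < δ ∧ δ < 1 ∧ ∃ n₀ : ℕ, ∀ n ≥ n₀,
      (volume {ω : Ω n | ENNReal.ofReal ε ≤ modulus (X n ω) δ})
        ≤ ENNReal.ofReal η := by
  obtain ⟨β, hβ, σ, hσ, C, hC, N, h1⟩ := h1
  intro ε hε η hη
  obtain ⟨θ, ρ, hθ, hθ1, hρ, hρ1, hθρ⟩ := exists_geometric_ratios hβ hσ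
  have hsmall : ∀ x : ℝ, 0 < x → x < 1 → ∀ c : ℝ, Filter.Tendsto
      (fun m : ℕ => c * (x ^ m / (1 - x))) Filter.atTop (nhds 0) := fun x hx hx1 c => by
    simpa using ((tendsto_pow_atTop_nhds_zero_of_lt_one hx.le hx1).div_const (1 - x)).const_mul c
  obtain ⟨m, ⟨hmθ, hmρ⟩, hm1⟩ :=
    (((hsmall θ hθ hθ1 6).eventually_lt_const (show 0 < ε / 2 by linarith)).and
      ((hsmall ρ hρ hρ1 (4 * C)).eventually_lt_const (show 0 < η / 2 by linarith))).and
      (Filter.eventually_ge_atTop 1) |>.exists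
  have he : 0 < ε / 32 := by linarith
  obtain ⟨n₁, hn₁⟩ := h2 (ε / 32) he (η / 2) (by linarith)
  refine ⟨(1 / 2) ^ m, by positivity, pow_lt_one₀ (by norm_num) (by norm_num) (by omega),
    max N n₁, fun n hn => ?_⟩
  have hfine := (hn₁ n (le_of_max_le_right hn)).le
  rcases le_or_gt ((1 / 2) ^ m) (δseq n) with hδm | hδm
  · calc volume {ω : Ω n | ENNReal.ofReal ε ≤ modulus (X n ω) ((1 / 2) ^ m)}
        ≤ volume {ω : Ω n | ENNReal.ofReal (ε / 32) < modulus (X n ω) (δseq n)} :=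
          measure_mono fun ω hω =>
            ((ENNReal.ofReal_lt_ofReal_iff hε).2 (by linarith)).trans_le
              (le_trans hω (modulus_mono _ hδm))
      _ ≤ ENNReal.ofReal (η / 2) := hfine
      _ ≤ ENNReal.ofReal η := ENNReal.ofReal_le_ofReal (by linarith)
  obtain ⟨K, hK, hK'⟩ : ∃ K : ℕ, (1 / 2 : ℝ) ^ (K + 1) ≤ δseq n ∧ δseq n < (1 / 2) ^ K := by
    classical
    have hex : ∃ L : ℕ, (1 / 2 : ℝ) ^ L ≤ δseq n :=
      (exists_pow_lt_of_lt_one (hδ n) (by norm_num)).imp fun _ h => h.le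
    obtain ⟨K, hK⟩ : ∃ K, Nat.find hex = K + 1 := Nat.exists_eq_succ_of_ne_zero fun h0 => by
      have := Nat.find_spec hex
      rw [h0, pow_zero] at this
      exact absurd (this.trans_lt hδm) (not_lt.2 (pow_le_one₀ (by norm_num) (by norm_num)))
    exact ⟨K, hK ▸ Nat.find_spec hex, not_le.1 (Nat.find_min hex (by omega))⟩
  have hmK : m ≤ K := by
    have := (pow_lt_pow_iff_right_of_lt_one₀ (show (0 : ℝ) < 1 / 2 by norm_num)
      (by norm_num)).1 (hK.trans_lt hδm)
    omega
  have hX : ∀ s q, Measurable fun ω => X n ω s q := fun s q =>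
    (hjm n).comp (measurable_id.prodMk (measurable_const (a := (s, q))))
  have hgrid : ∀ k ∈ Finset.Ico m (K + 1),
      volume {ω : Ω n | ¬ GridIncrementsLE (X n ω) k (θ ^ k)} ≤ ENNReal.ofReal (4 * C * ρ ^ k) := by
    intro k hk
    rw [← hθρ k]
    refine measure_not_gridIncrementsLE_le hX hβ hC (h1 n (le_of_max_le_left hn))
      (hK'.trans_le ?_) (by positivity)
    exact pow_le_pow_of_le_one (by norm_num) (by norm_num)
      (Nat.lt_succ_iff.1 (Finset.mem_Ico.1 hk).2)
  have hsub : {ω : Ω n | ENNReal.ofReal ε ≤ modulus (X n ω) ((1 / 2) ^ m)} ⊆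
      {ω : Ω n | ENNReal.ofReal (ε / 32) < modulus (X n ω) (δseq n)} ∪
        ⋃ k ∈ Finset.Ico m (K + 1), {ω : Ω n | ¬ GridIncrementsLE (X n ω) k (θ ^ k)} := by
    intro ω hω
    by_contra hnot
    simp only [mem_union, mem_iUnion, mem_ofPred_eq, not_or, not_lt, not_exists, not_not,
      Finset.mem_Ico] at hnot
    refine absurd (hω.out.trans (modulus_le_of_gridIncrementsLE (a := fun k => θ ^ k)
      (fun k => by positivity) hmK (fun k h₁ h₂ => hnot.2 k ⟨h₁, by omega⟩) he.le ?_ hnot.1)) ?_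
    · rw [pow_succ] at hK
      linarith
    · rw [not_le, ENNReal.ofReal_lt_ofReal_iff hε]
      have hsum : ∑ k ∈ Finset.Ico m K, θ ^ (k + 1) ≤ θ ^ m / (1 - θ) :=
        (Finset.sum_le_sum fun k _ =>
          pow_le_pow_of_le_one hθ.le hθ1.le k.le_succ).trans (geom_sum_Ico_le_of_lt_one hθ.le hθ1)
      have hfirst : θ ^ m ≤ θ ^ m / (1 - θ) :=
        le_div_self (by positivity) (by linarith) (by linarith)
      linarith
  calc volume {ω : Ω n | ENNReal.ofReal ε ≤ modulus (X n ω) ((1 / 2) ^ m)}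
      ≤ ENNReal.ofReal (η / 2) + ∑ k ∈ Finset.Ico m (K + 1), ENNReal.ofReal (4 * C * ρ ^ k) :=
        (measure_mono hsub).trans <| (measure_union_le _ _).trans <| add_le_add hfine <|
          (measure_biUnion_finset_le _ _).trans (Finset.sum_le_sum hgrid)
    _ = ENNReal.ofReal (η / 2 + 4 * C * ∑ k ∈ Finset.Ico m (K + 1), ρ ^ k) := by
        rw [← ENNReal.ofReal_sum_of_nonneg fun k _ => by positivity, ← Finset.mul_sum,
          ENNReal.ofReal_add (by positivity) (by positivity)]
    _ ≤ ENNReal.ofReal η := by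
        apply ENNReal.ofReal_le_ofReal
        have : 4 * C * ∑ k ∈ Finset.Ico m (K + 1), ρ ^ k ≤ 4 * C * (ρ ^ m / (1 - ρ)) :=
          mul_le_mul_of_nonneg_left (geom_sum_Ico_le_of_lt_one hρ.le hρ1) (by positivity)
        linarith
end

section
/- (Dyadic grid connection lemma.) Let 0 ≤ k₀ ≤ k be integers and let (s,q) and (t,r) be points of the 2^{-k} grid (i.e. s = i/2^k, q = j/2^k, t = i′/2^k, r = j′/2^k for integers i, j, i′, j′) with |s − t| ≤ 2^{-k₀} and |q − r| ≤ 2^{-k₀}. Then there exist m ∈ ℕ and a finite sequence of points p₀ = (s,q), p₁, …, p_m = (t,r) in ℝ² together with integers h₁, …, h_m ∈ [k₀, k] such that for each step i: p_i and p_{i−1} differ in exactly one coordinate, the difference in that coordinate is ±2^{-h_i}, and both coordinates of p_{i−1} (hence also of p_i) are integer multiples of 2^{-h_i}; moreover, for each h ∈ [k₀, k], the number of indices i with h_i = h is at most 4. -/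
open Finset

/-- The point `(i / 2^k, j / 2^k)` of the `2^{-k}` grid. -/
noncomputable def gridPoint (k : ℕ) (i j : ℤ) : ℝ × ℝ := ((i : ℝ) / 2 ^ k, (j : ℝ) / 2 ^ k)

/-- `GridStep h P Q` says that `Q` is obtained from the point `P` of the `2^{-h}` grid by changing
one coordinate by `2^{-h}`. -/
def GridStep (h : ℕ) (P Q : ℝ × ℝ) : Prop :=
  ((Q.1 = P.1 ∧ |Q.2 - P.2| = 1 / 2 ^ h) ∨ (Q.2 = P.2 ∧ |Q.1 - P.1| = 1 / 2 ^ h)) ∧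
    ∃ a b : ℤ, P.1 = (a : ℝ) / 2 ^ h ∧ P.2 = (b : ℝ) / 2 ^ h

/-- `GridPath P Q L` says that `P` is joined to `Q` by grid steps whose levels form the
multiset `L`. -/
inductive GridPath (P : ℝ × ℝ) : ℝ × ℝ → Multiset ℕ → Prop
  | nil : GridPath P P 0
  | snoc {Q R : ℝ × ℝ} {L : Multiset ℕ} {h : ℕ} :
      GridPath P Q L → GridStep h Q R → GridPath P R (h ::ₘ L)

theorem GridPath.trans {P Q R : ℝ × ℝ} {L M : Multiset ℕ} (hPQ : GridPath P Q L)
    (hQR : GridPath Q R M) : GridPath P R (M + L) := by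
  induction hQR with
  | nil => simpa using hPQ
  | snoc _ hstep ih => simpa [Multiset.cons_add] using ih.snoc hstep

theorem gridPoint_succ_two_mul (k : ℕ) (a b : ℤ) :
    gridPoint (k + 1) (2 * a) (2 * b) = gridPoint k a b := by
  simp only [gridPoint, pow_succ, Int.cast_mul, Int.cast_ofNat, Prod.mk.injEq]
  constructor <;> field_simp

theorem gridStep_fst (k : ℕ) {i i' : ℤ} (j : ℤ) (hi : |i' - i| = 1) :
    GridStep k (gridPoint k i j) (gridPoint k i' j) := by
  refine ⟨Or.inr ⟨rfl, ?_⟩, i, j, rfl, rfl⟩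
  have hi' : |(i' : ℝ) - i| = 1 := by exact_mod_cast hi
  simp only [gridPoint]
  rw [← sub_div, abs_div, hi', abs_of_pos (by positivity : (0 : ℝ) < 2 ^ k)]

theorem gridStep_snd (k : ℕ) (i : ℤ) {j j' : ℤ} (hj : |j' - j| = 1) :
    GridStep k (gridPoint k i j) (gridPoint k i j') := by
  refine ⟨Or.inl ⟨rfl, ?_⟩, i, j, rfl, rfl⟩
  have hj' : |(j' : ℝ) - j| = 1 := by exact_mod_cast hj
  simp only [gridPoint]
  rw [← sub_div, abs_div, hj', abs_of_pos (by positivity : (0 : ℝ) < 2 ^ k)]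

theorem exists_gridPath_of_abs_sub_le_one (k : ℕ) {i j i' j' : ℤ} (hi : |i' - i| ≤ 1)
    (hj : |j' - j| ≤ 1) :
    ∃ n ≤ 2, GridPath (gridPoint k i j) (gridPoint k i' j') (Multiset.replicate n k) := by
  have key {d : ℤ} (hd : |d| ≤ 1) : d = 0 ∨ |d| = 1 := by grind
  rcases key hi with hi | hi <;> rcases key hj with hj | hj
  · obtain rfl := sub_eq_zero.mp hi
    obtain rfl := sub_eq_zero.mp hj
    exact ⟨0, by simp, .nil⟩
  · obtain rfl := sub_eq_zero.mp hi
    exact ⟨1, by simp, GridPath.nil.snoc (gridStep_snd k _ hj)⟩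
  · obtain rfl := sub_eq_zero.mp hj
    exact ⟨1, by simp, GridPath.nil.snoc (gridStep_fst k _ hi)⟩
  · exact ⟨2, le_rfl, (GridPath.nil.snoc (gridStep_fst k _ hi)).snoc (gridStep_snd k _ hj)⟩

theorem exists_gridPath_of_abs_sub_le_two_pow (k₀ n : ℕ) {i j i' j' : ℤ}
    (hi : |i' - i| ≤ 2 ^ n) (hj : |j' - j| ≤ 2 ^ n) :
    ∃ L : Multiset ℕ, GridPath (gridPoint (k₀ + n) i j) (gridPoint (k₀ + n) i' j') L ∧
      (∀ h ∈ L, k₀ ≤ h ∧ h ≤ k₀ + n) ∧ ∀ h, L.count h ≤ 4 := by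
  induction n generalizing i j i' j' with
  | zero =>
    obtain ⟨m, hm, hp⟩ := exists_gridPath_of_abs_sub_le_one k₀ (by simpa using hi) (by simpa using hj)
    refine ⟨_, hp, fun h hh => ?_, fun h => ?_⟩
    · have := Multiset.eq_of_mem_replicate hh
      omega
    · rw [Multiset.count_replicate]
      split_ifs <;> omega
  | succ n ih =>
    have half {x y : ℤ} (hxy : |y - x| ≤ 2 ^ (n + 1)) :
        |(y + 1) / 2 - (x + 1) / 2| ≤ 2 ^ n := by
      rw [pow_succ] at hxy
      rw [abs_le] at hxy ⊢
      omega
    have round_up (x : ℤ) : |2 * ((x + 1) / 2) - x| ≤ 1 := by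
      rw [abs_le]
      omega
    obtain ⟨L, hL, hmem, hcount⟩ := ih (half hi) (half hj)
    obtain ⟨m, hm, hp⟩ := exists_gridPath_of_abs_sub_le_one (k₀ + n + 1) (round_up i) (round_up j)
    obtain ⟨m', hm', hp'⟩ := exists_gridPath_of_abs_sub_le_one (k₀ + n + 1)
      (abs_sub_comm i' _ ▸ round_up i') (abs_sub_comm j' _ ▸ round_up j')
    rw [gridPoint_succ_two_mul] at hp hp'
    refine ⟨_, (hp.trans hL).trans hp', fun h hh => ?_, fun h => ?_⟩
    · simp only [Multiset.mem_add, Multiset.mem_replicate] at hh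
      have := hmem h
      grind
    · have hc := hcount h
      simp only [Multiset.count_add, Multiset.count_replicate]
      split_ifs with hh
      · have : L.count h = 0 := Multiset.count_eq_zero_of_notMem fun hL => by
          have := hmem h hL
          omega
        omega
      · omega

theorem GridPath.exists_sequence {P Q : ℝ × ℝ} {L : Multiset ℕ} (hPQ : GridPath P Q L) :
    ∃ (m : ℕ) (p : ℕ → ℝ × ℝ) (h : ℕ → ℕ), p 0 = P ∧ p m = Q ∧
      (∀ l : ℕ, 1 ≤ l → l ≤ m → h l ∈ L ∧ GridStep (h l) (p (l - 1)) (p l)) ∧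
      ∀ hh : ℕ, ((Icc 1 m).filter fun l => h l = hh).card = L.count hh := by
  induction hPQ with
  | nil => exact ⟨0, fun _ => P, fun _ => 0, rfl, rfl, by omega, by simp⟩
  | @snoc Q R L a _ hstep ih =>
    obtain ⟨m, p, h, h0, hm, hsteps, hcard⟩ := ih
    refine ⟨m + 1, Function.update p (m + 1) R, Function.update h (m + 1) a, ?_, by simp, ?_, ?_⟩
    · rw [Function.update_of_ne (by omega), h0]
    · intro l hl hlm
      rcases hlm.eq_or_lt with rfl | hlt
      · rw [Function.update_self, Function.update_self, Function.update_of_ne (by omega),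
          Nat.add_sub_cancel, hm]
        exact ⟨Multiset.mem_cons_self _ _, hstep⟩
      · rw [Function.update_of_ne (by omega), Function.update_of_ne (by omega),
          Function.update_of_ne (by omega)]
        obtain ⟨hmem, hs⟩ := hsteps l hl (by omega)
        exact ⟨Multiset.mem_cons_of_mem hmem, hs⟩
    · intro hh
      have hfilter : ((Icc 1 m).filter fun l => Function.update h (m + 1) a l = hh) =
          (Icc 1 m).filter fun l => h l = hh := by
        refine filter_congr fun l hl => ?_
        rw [Function.update_of_ne (by have := mem_Icc.mp hl; omega)]
      rw [← insert_Icc_right_eq_Icc_add_one (by omega), filter_insert, hfilter,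
        Function.update_self, Multiset.count_cons, ← hcard]
      by_cases hah : a = hh
      · simp [hah]
      · simp [hah, Ne.symm hah]

theorem abs_sub_le_two_pow_of_div {k₀ n : ℕ} {x y : ℤ}
    (h : |(x : ℝ) / 2 ^ (k₀ + n) - (y : ℝ) / 2 ^ (k₀ + n)| ≤ 1 / 2 ^ k₀) :
    |y - x| ≤ 2 ^ n := by
  rw [← sub_div, abs_div, abs_of_pos (by positivity : (0 : ℝ) < 2 ^ (k₀ + n)),
    div_le_div_iff₀ (by positivity) (by positivity), one_mul, pow_add, mul_comm,
    mul_le_mul_iff_right₀ (by positivity)] at h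
  rw [abs_sub_comm]
  exact_mod_cast h

/-- dyadic grid connection lemma: two points of the `2^{-k}` grid at distance
at most `2^{-k₀}` in each coordinate can be joined by a path moving one coordinate at a time
in steps of sizes `2^{-h}` with `k₀ ≤ h ≤ k`, each jump of size `2^{-h}` starting from a
point of the `2^{-h}` grid, and with each step size used at most 4 times. -/
theorem dyadic_grid_connection (k₀ k : ℕ) (hk : k₀ ≤ k) (i j i' j' : ℤ)
    (s q t r : ℝ)
    (hs : s = (i : ℝ) / 2 ^ k) (hq : q = (j : ℝ) / 2 ^ k)
    (ht : t = (i' : ℝ) / 2 ^ k) (hr : r = (j' : ℝ) / 2 ^ k)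
    (hst : |s - t| ≤ 1 / 2 ^ k₀) (hqr : |q - r| ≤ 1 / 2 ^ k₀) :
    ∃ (m : ℕ) (p : ℕ → ℝ × ℝ) (h : ℕ → ℕ),
      p 0 = (s, q) ∧ p m = (t, r) ∧
      (∀ l : ℕ, 1 ≤ l → l ≤ m →
        (k₀ ≤ h l ∧ h l ≤ k) ∧
        (((p l).1 = (p (l - 1)).1 ∧ |(p l).2 - (p (l - 1)).2| = 1 / 2 ^ (h l)) ∨
         ((p l).2 = (p (l - 1)).2 ∧ |(p l).1 - (p (l - 1)).1| = 1 / 2 ^ (h l))) ∧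
        (∃ a b : ℤ, (p (l - 1)).1 = (a : ℝ) / 2 ^ (h l) ∧ (p (l - 1)).2 = (b : ℝ) / 2 ^ (h l))) ∧
      ∀ hh : ℕ, ((Finset.Icc 1 m).filter fun l => h l = hh).card ≤ 4 := by
  subst hs hq ht hr
  obtain ⟨n, rfl⟩ := Nat.exists_eq_add_of_le hk
  obtain ⟨L, hL, hmem, hcount⟩ := exists_gridPath_of_abs_sub_le_two_pow k₀ n
    (abs_sub_le_two_pow_of_div hst) (abs_sub_le_two_pow_of_div hqr)
  obtain ⟨m, p, h, h0, hm, hsteps, hcard⟩ := hL.exists_sequence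
  refine ⟨m, p, h, h0, hm, fun l hl hlm => ?_, fun hh => (hcard hh).trans_le (hcount hh)⟩
  obtain ⟨hl_mem, hdiff, hgrid⟩ := hsteps l hl hlm
  exact ⟨hmem _ hl_mem, hdiff, hgrid⟩
end

section
/- For every a > 0 and every x ∈ ℝ, sup_{λ∈ℝ} [ xλ − a(e^λ + e^{−λ} − 2) ] = x·log( x/(2a) + √(1 + x²/(4a²)) ) − 2a·( √(1 + x²/(4a²)) − 1 ). In particular, taking a = ρ√(κ₂t/(2π)) with ρ, κ₂, t > 0, the convex dual of λ ↦ ρ√(κ₂t/(2π))(e^λ + e^{−λ} − 2) equals x·log( x√π/(ρ√(2κ₂t)) + √(1 + x²π/(2ρ²κ₂t)) ) − ρ√(2κ₂t/π)·( √(1 + x²π/(2ρ²κ₂t)) − 1 ). -/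
open Real

/-- The supremum is attained at `arsinh (x / (2 * a))`. -/
theorem isGreatest_range_mul_sub_cosh (a x : ℝ) (ha : 0 < a) :
    IsGreatest (Set.range fun lam : ℝ ↦ x * lam - a * (exp lam + exp (-lam) - 2))
      (x * log (x / (2 * a) + √(1 + x ^ 2 / (4 * a ^ 2)))
        - 2 * a * (√(1 + x ^ 2 / (4 * a ^ 2)) - 1)) := by
  have hsq : x ^ 2 / (4 * a ^ 2) = (x / (2 * a)) ^ 2 := by
    field_simp
    norm_num
  rw [hsq]
  change IsGreatest _ (x * arsinh (x / (2 * a)) - 2 * a * (√(1 + (x / (2 * a)) ^ 2) - 1))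
  rw [← cosh_arsinh]
  set u := arsinh (x / (2 * a)) with hu
  have hx : x = 2 * a * sinh u := by
    rw [hu, sinh_arsinh]
    field_simp
  refine ⟨⟨u, ?_⟩, ?_⟩
  · simp only [cosh_eq]
    ring
  · rintro _ ⟨lam, rfl⟩
    have h₁ : exp u * (1 + (lam - u)) ≤ exp lam := by
      calc exp u * (1 + (lam - u)) ≤ exp u * exp (lam - u) := by
            gcongr
            linarith [add_one_le_exp (lam - u)]
        _ = exp lam := by rw [← exp_add]; congr 1; ring
    have h₂ : exp (-u) * (1 - (lam - u)) ≤ exp (-lam) := by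
      calc exp (-u) * (1 - (lam - u)) ≤ exp (-u) * exp (-(lam - u)) := by
            gcongr
            exact one_sub_le_exp_neg (lam - u)
        _ = exp (-lam) := by rw [← exp_add]; congr 1; ring
    have h := mul_le_mul_of_nonneg_left (add_le_add h₁ h₂) ha.le
    simp only
    rw [hx, sinh_eq, cosh_eq]
    linarith

theorem iSup_mul_sub_cosh (a x : ℝ) (ha : 0 < a) :
    (⨆ lam : ℝ, (x * lam - a * (exp lam + exp (-lam) - 2)))
      = x * log (x / (2 * a) + √(1 + x ^ 2 / (4 * a ^ 2)))
        - 2 * a * (√(1 + x ^ 2 / (4 * a ^ 2)) - 1) :=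
  (isGreatest_range_mul_sub_cosh a x ha).csSup_eq

/-- the convex dual of `λ ↦ a(e^λ + e^{−λ} − 2)` and its specialization to
`a = ρ√(κ₂t/(2π))`. -/
theorem dual_of_cosh :
    (∀ a x : ℝ, 0 < a →
      (⨆ lam : ℝ, (x * lam - a * (Real.exp lam + Real.exp (-lam) - 2)))
        = x * Real.log (x / (2 * a) + Real.sqrt (1 + x ^ 2 / (4 * a ^ 2)))
          - 2 * a * (Real.sqrt (1 + x ^ 2 / (4 * a ^ 2)) - 1)) ∧
    ∀ ρ κ₂ t x : ℝ, 0 < ρ → 0 < κ₂ → 0 < t →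
      (⨆ lam : ℝ,
          (x * lam - ρ * Real.sqrt (κ₂ * t / (2 * Real.pi))
            * (Real.exp lam + Real.exp (-lam) - 2)))
        = x * Real.log (x * Real.sqrt Real.pi / (ρ * Real.sqrt (2 * κ₂ * t))
              + Real.sqrt (1 + x ^ 2 * Real.pi / (2 * ρ ^ 2 * κ₂ * t)))
          - ρ * Real.sqrt (2 * κ₂ * t / Real.pi)
            * (Real.sqrt (1 + x ^ 2 * Real.pi / (2 * ρ ^ 2 * κ₂ * t)) - 1) := by
  refine ⟨iSup_mul_sub_cosh, fun ρ κ₂ t x hρ hκ ht ↦ ?_⟩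
  have hpi := Real.pi_pos
  have hs : 0 < √(κ₂ * t / (2 * π)) := by positivity
  rw [iSup_mul_sub_cosh _ x (mul_pos hρ hs)]
  have hsq : √(κ₂ * t / (2 * π)) ^ 2 = κ₂ * t / (2 * π) := sq_sqrt (by positivity)
  have h₁ : √(2 * κ₂ * t / π) = 2 * √(κ₂ * t / (2 * π)) := by
    rw [sqrt_eq_iff_mul_self_eq_of_pos (by positivity)]
    linear_combination 4 * hsq + (by field_simp; norm_num :
      4 * (κ₂ * t / (2 * π)) = 2 * κ₂ * t / π)
  have h₂ : √(2 * κ₂ * t) = 2 * √(κ₂ * t / (2 * π)) * √π := by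
    rw [← h₁, ← sqrt_mul (by positivity), div_mul_cancel₀ _ hpi.ne']
  have h₃ : x ^ 2 / (4 * (ρ * √(κ₂ * t / (2 * π))) ^ 2)
      = x ^ 2 * π / (2 * ρ ^ 2 * κ₂ * t) := by
    rw [mul_pow, hsq]
    field_simp
    norm_num
  have h₄ : x * √π / (ρ * √(2 * κ₂ * t)) = x / (2 * (ρ * √(κ₂ * t / (2 * π)))) := by
    have : 0 < √π := sqrt_pos.2 hpi
    rw [h₂]
    field_simp
  rw [h₃, h₄, h₁]
  ring
end

section
/- Under the stated assumptions on γ, the convex dual of Λ evaluated along the range of Λ′ decomposes into the two cost integrals: for every α ∈ ℝ, α·Λ′(α) − Λ(α) = ∫_{−∞}^{∞} γ*( γ′(Z_α(y)) ) dy + ∫_{−∞}^{∞} γ′(Z_α(y))·Br*_{Φ_{κ₂t}(y)}( F_α(y) ) dy. Equivalently, Λ*(Λ′(α)) = I₁ + I₂ evaluated at the tilt α, where Λ*(x) = sup_{λ∈ℝ}(xλ − Λ(λ)). -/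
open MeasureTheory Real

/-- The logarithmic moment generating function of a Bernoulli variable with success probability
`q`. -/
noncomputable def bernoulliCgf (q s : ℝ) : ℝ := Real.log (1 - q + Real.exp s * q)

/-- The success probability of a Bernoulli variable exponentially tilted by `s`. -/
noncomputable def bernoulliTilt (q s : ℝ) : ℝ := Real.exp s * q / (1 - q + Real.exp s * q)

section Bernoulli

variable {q : ℝ}

lemma bernoulli_mgf_pos (h0 : 0 < q) (h1 : q < 1) (s : ℝ) : 0 < 1 - q + Real.exp s * q := by
  have := mul_pos (Real.exp_pos s) h0
  linarith

lemma hasDerivAt_bernoulliCgf (h0 : 0 < q) (h1 : q < 1) (s : ℝ) :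
    HasDerivAt (bernoulliCgf q) (bernoulliTilt q s) s :=
  (((Real.hasDerivAt_exp s).mul_const q).const_add (1 - q)).log (bernoulli_mgf_pos h0 h1 s).ne'

lemma bernoulliTilt_pos (h0 : 0 < q) (h1 : q < 1) (s : ℝ) : 0 < bernoulliTilt q s :=
  div_pos (mul_pos (Real.exp_pos s) h0) (bernoulli_mgf_pos h0 h1 s)

lemma one_sub_bernoulliTilt (h0 : 0 < q) (h1 : q < 1) (s : ℝ) :
    1 - bernoulliTilt q s = (1 - q) / (1 - q + Real.exp s * q) := by
  have := (bernoulli_mgf_pos h0 h1 s).ne'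
  rw [bernoulliTilt]
  field_simp
  ring

lemma bernoulliTilt_lt_one (h0 : 0 < q) (h1 : q < 1) (s : ℝ) : bernoulliTilt q s < 1 := by
  have h : 0 < 1 - bernoulliTilt q s := by
    rw [one_sub_bernoulliTilt h0 h1]
    exact div_pos (by linarith) (bernoulli_mgf_pos h0 h1 s)
  linarith

lemma bernoulliCgf_add_le (h0 : 0 < q) (h1 : q < 1) (s r : ℝ) :
    bernoulliCgf q s + bernoulliTilt q s * (r - s) ≤ bernoulliCgf q r := by
  have hs := bernoulli_mgf_pos h0 h1 s
  have hT0 := bernoulliTilt_pos h0 h1 s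
  have hT1 := bernoulliTilt_lt_one h0 h1 s
  have hconv := convexOn_exp.2 (Set.mem_univ (0 : ℝ)) (Set.mem_univ (r - s))
    (by linarith : 0 ≤ 1 - bernoulliTilt q s) hT0.le (by ring)
  simp only [smul_eq_mul, mul_zero, zero_add, Real.exp_zero, mul_one] at hconv
  rw [bernoulliCgf, bernoulliCgf, Real.le_log_iff_exp_le (bernoulli_mgf_pos h0 h1 r),
    Real.exp_add, Real.exp_log hs]
  refine (mul_le_mul_of_nonneg_left hconv hs.le).trans (le_of_eq ?_)
  rw [one_sub_bernoulliTilt h0 h1, bernoulliTilt, Real.exp_sub]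
  have hs' : 1 - q + q * Real.exp s ≠ 0 := by
    rw [mul_comm q]
    exact hs.ne'
  field_simp

lemma bernoulliCgf_zero (q : ℝ) : bernoulliCgf q 0 = 0 := by simp [bernoulliCgf]

lemma exp_neg_abs_le_bernoulli_mgf (h0 : 0 < q) (h1 : q < 1) (s : ℝ) :
    Real.exp (-|s|) ≤ 1 - q + Real.exp s * q := by
  have ha : Real.exp (-|s|) ≤ 1 := Real.exp_le_one_iff.2 (by simp)
  have hb : Real.exp (-|s|) ≤ Real.exp s := Real.exp_le_exp.2 (neg_abs_le s)
  nlinarith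

lemma bernoulliTilt_le (h0 : 0 < q) (h1 : q < 1) {s R : ℝ} (hs : |s| ≤ R) :
    bernoulliTilt q s ≤ Real.exp (2 * R) * q := by
  rw [bernoulliTilt, div_le_iff₀ (bernoulli_mgf_pos h0 h1 s)]
  have ha : Real.exp s ≤ Real.exp R := Real.exp_le_exp.2 ((le_abs_self s).trans hs)
  have hb : Real.exp (-R) ≤ 1 - q + Real.exp s * q :=
    (Real.exp_le_exp.2 (by linarith)).trans (exp_neg_abs_le_bernoulli_mgf h0 h1 s)
  have hc : Real.exp (2 * R) * Real.exp (-R) = Real.exp R := by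
    rw [← Real.exp_add]
    ring_nf
  calc Real.exp s * q ≤ Real.exp R * q := by gcongr
    _ = Real.exp (2 * R) * q * Real.exp (-R) := by rw [← hc]; ring
    _ ≤ _ := by gcongr

lemma abs_bernoulliCgf_le (h0 : 0 < q) (h1 : q < 1) {s R : ℝ} (hs : |s| ≤ R) :
    |bernoulliCgf q s| ≤ R * (Real.exp (2 * R) * q) := by
  have hR : 0 ≤ R := (abs_nonneg s).trans hs
  have hl := bernoulliCgf_add_le h0 h1 0 s
  have hu := bernoulliCgf_add_le h0 h1 s 0
  rw [bernoulliCgf_zero] at hl hu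
  have key : ∀ r, |r| ≤ R → |bernoulliTilt q r * s| ≤ R * (Real.exp (2 * R) * q) := by
    intro r hr
    rw [abs_mul, abs_of_pos (bernoulliTilt_pos h0 h1 r), mul_comm]
    exact mul_le_mul hs (bernoulliTilt_le h0 h1 hr) (bernoulliTilt_pos h0 h1 r).le hR
  have k0 := abs_le.1 (key 0 (by simpa using hR))
  have ks := abs_le.1 (key s hs)
  exact abs_le.2 ⟨by linarith, by linarith⟩

lemma abs_bernoulliCgf_le_abs (h0 : 0 < q) (h1 : q < 1) (s : ℝ) : |bernoulliCgf q s| ≤ |s| := by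
  have hl := bernoulliCgf_add_le h0 h1 0 s
  have hu := bernoulliCgf_add_le h0 h1 s 0
  rw [bernoulliCgf_zero] at hl hu
  have key : ∀ r, |bernoulliTilt q r * s| ≤ |s| := by
    intro r
    rw [abs_mul, abs_of_pos (bernoulliTilt_pos h0 h1 r)]
    exact mul_le_of_le_one_left (abs_nonneg s) (bernoulliTilt_lt_one h0 h1 r).le
  have k0 := abs_le.1 (key 0)
  have ks := abs_le.1 (key s)
  exact abs_le.2 ⟨by linarith, by linarith⟩

/-- The relative entropy of a tilted Bernoulli variable with respect to the original one. -/
lemma bernoulli_relative_entropy_tilt (h0 : 0 < q) (h1 : q < 1) (s : ℝ) :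
    bernoulliTilt q s * Real.log (bernoulliTilt q s / q) +
      (1 - bernoulliTilt q s) * Real.log ((1 - bernoulliTilt q s) / (1 - q)) =
      s * bernoulliTilt q s - bernoulliCgf q s := by
  have hs := bernoulli_mgf_pos h0 h1 s
  have hq : 1 - q ≠ 0 := by linarith
  have ha : bernoulliTilt q s / q = Real.exp s / (1 - q + Real.exp s * q) := by
    rw [bernoulliTilt]
    field_simp
  have hb : (1 - bernoulliTilt q s) / (1 - q) = (1 - q + Real.exp s * q)⁻¹ := by
    rw [one_sub_bernoulliTilt h0 h1]
    field_simp
  rw [ha, hb, Real.log_div (Real.exp_pos s).ne' hs.ne', Real.log_exp, Real.log_inv, bernoulliCgf]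
  ring

end Bernoulli

section Cgf

open ProbabilityTheory

variable {Ω : Type*} [MeasurableSpace Ω] {μ : Measure Ω} {X : Ω → ℝ}

lemma mem_interior_integrableExpSet_of_forall
    (hX : ∀ s : ℝ, Integrable (fun ω => Real.exp (s * X ω)) μ) (s : ℝ) :
    s ∈ interior (integrableExpSet X μ) := by
  have : integrableExpSet X μ = Set.univ := Set.eq_univ_of_forall hX
  simp [this]

lemma differentiable_cgf_of_forall
    (hX : ∀ s : ℝ, Integrable (fun ω => Real.exp (s * X ω)) μ) :
    Differentiable ℝ (cgf X μ) := fun s =>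
  (analyticAt_cgf (mem_interior_integrableExpSet_of_forall hX s)).differentiableAt

lemma deriv_cgf_nonneg (hX : ∀ s : ℝ, Integrable (fun ω => Real.exp (s * X ω)) μ)
    (h0 : ∀ ω, 0 ≤ X ω) (s : ℝ) : 0 ≤ deriv (cgf X μ) s := by
  rw [deriv_cgf (mem_interior_integrableExpSet_of_forall hX s)]
  exact div_nonneg (integral_nonneg fun ω => mul_nonneg (h0 ω) (Real.exp_pos _).le) mgf_nonneg

/-- The cumulant generating function lies above its tangent lines. -/
lemma cgf_add_deriv_mul_le [IsProbabilityMeasure μ]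
    (hX : ∀ s : ℝ, Integrable (fun ω => Real.exp (s * X ω)) μ)
    (s r : ℝ) : cgf X μ s + deriv (cgf X μ) s * (r - s) ≤ cgf X μ r := by
  have hs := mem_interior_integrableExpSet_of_forall hX s
  have hpos : ∀ v, 0 < mgf X μ v := fun v => mgf_pos (hX v)
  have hm : deriv (cgf X μ) s * mgf X μ s = ∫ ω, X ω * Real.exp (s * X ω) ∂μ := by
    rw [deriv_cgf hs, div_mul_cancel₀ _ (hpos s).ne']
  set m := deriv (cgf X μ) s
  have hi : Integrable (fun ω => X ω * Real.exp (s * X ω)) μ := by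
    simpa using integrable_pow_mul_exp_of_mem_interior_integrableExpSet hs 1
  have hint : ∫ ω, ((1 - (r - s) * m) * Real.exp (s * X ω) +
      (r - s) * (X ω * Real.exp (s * X ω))) ∂μ ≤
      ∫ ω, Real.exp (-(m * (r - s))) * Real.exp (r * X ω) ∂μ := by
    refine integral_mono (((hX s).const_mul _).add (hi.const_mul _)) ((hX r).const_mul _) ?_
    intro ω
    have h1 := Real.add_one_le_exp ((r - s) * (X ω - m))
    have h2 : Real.exp (-(m * (r - s))) * Real.exp (r * X ω) =
        Real.exp ((r - s) * (X ω - m)) * Real.exp (s * X ω) := by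
      rw [← Real.exp_add, ← Real.exp_add]
      ring_nf
    have h3 := mul_le_mul_of_nonneg_right h1 (Real.exp_pos (s * X ω)).le
    simp only [h2]
    linarith
  rw [integral_add ((hX s).const_mul _) (hi.const_mul _), integral_const_mul, integral_const_mul,
    integral_const_mul, ← hm] at hint
  change (1 - (r - s) * m) * mgf X μ s + _ ≤ _ * mgf X μ r at hint
  have hle : mgf X μ s ≤ Real.exp (-(m * (r - s))) * mgf X μ r := by linarith
  have hlog := Real.log_le_log (hpos s) hle
  rw [Real.log_mul (Real.exp_pos _).ne' (hpos r).ne', Real.log_exp] at hlog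
  change Real.log (mgf X μ s) + m * (r - s) ≤ Real.log (mgf X μ r)
  linarith

end Cgf

section Tangent

variable {g : ℝ → ℝ}

lemma monotone_deriv_of_tangent_le
    (hg : ∀ s r, g s + deriv g s * (r - s) ≤ g r) : Monotone (deriv g) := by
  intro a b hab
  rcases hab.eq_or_lt with rfl | hlt
  · exact le_rfl
  have h1 := hg a b
  have h2 := hg b a
  nlinarith

/-- The convex conjugate at a slope attained at `z`. -/
lemma iSup_mul_sub_eq_of_tangent_le {f : ℝ → ℝ} {m z : ℝ}
    (hf : ∀ r, f z + m * (r - z) ≤ f r) : ⨆ r : ℝ, (r * m - f r) = z * m - f z := by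
  have hub : ∀ r, r * m - f r ≤ z * m - f z := fun r => by linarith [hf r]
  refine le_antisymm (ciSup_le hub) ?_
  exact le_ciSup (f := fun r : ℝ => r * m - f r) ⟨_, Set.forall_mem_range.2 hub⟩ z

lemma abs_le_mul_abs_of_tangent_le (hg : ∀ s r, g s + deriv g s * (r - s) ≤ g r)
    (hg' : ∀ s, 0 ≤ deriv g s) (hzero : g 0 = 0) {z R : ℝ} (hz : |z| ≤ R) :
    |g z| ≤ deriv g R * |z| := by
  have hmono := monotone_deriv_of_tangent_le hg
  have hl := hg 0 z
  have hu := hg z 0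
  rw [hzero] at hl hu
  have key : ∀ r, r ≤ R → |deriv g r * z| ≤ deriv g R * |z| := by
    intro r hr
    rw [abs_mul, abs_of_nonneg (hg' r)]
    exact mul_le_mul_of_nonneg_right (hmono hr) (abs_nonneg z)
  have k0 := abs_le.1 (key 0 ((abs_nonneg z).trans hz))
  have kz := abs_le.1 (key z ((le_abs_self z).trans hz))
  exact abs_le.2 ⟨by linarith, by linarith⟩

end Tangent

section Integral

variable {g h ε : ℝ → ℝ}

lemma measurable_bernoulliCgf_comp (hh : Measurable h) (hε : Measurable ε) (s : ℝ) :
    Measurable fun y => bernoulliCgf (h y) (ε y * s) := by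
  unfold bernoulliCgf
  fun_prop

lemma measurable_bernoulliTilt_comp (hh : Measurable h) (hε : Measurable ε) (s : ℝ) :
    Measurable fun y => bernoulliTilt (h y) (ε y * s) := by
  unfold bernoulliTilt
  fun_prop

/-- Integrals of the form `∫ g (bernoulliCgf (h y) (ε y * s)) dy` are differentiable in `s` under
the integral sign. -/
theorem hasDerivAt_integral_bernoulliCgf_comp (hgd : Differentiable ℝ g)
    (hg : ∀ s r, g s + deriv g s * (r - s) ≤ g r) (hg' : ∀ s, 0 ≤ deriv g s) (hzero : g 0 = 0)
    (hh : Measurable h) (h0 : ∀ y, 0 < h y) (h1 : ∀ y, h y < 1) (hhi : Integrable h)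
    (hε : Measurable ε) (hε1 : ∀ y, |ε y| = 1) (s : ℝ) :
    Integrable (fun y => g (bernoulliCgf (h y) (ε y * s))) ∧
    Integrable (fun y => deriv g (bernoulliCgf (h y) (ε y * s)) *
      (bernoulliTilt (h y) (ε y * s) * ε y)) ∧
    HasDerivAt (fun r => ∫ y, g (bernoulliCgf (h y) (ε y * r)))
      (∫ y, deriv g (bernoulliCgf (h y) (ε y * s)) *
        (bernoulliTilt (h y) (ε y * s) * ε y)) s := by
  have hmono := monotone_deriv_of_tangent_le hg
  have habs : ∀ y r, |ε y * r| = |r| := fun y r => by rw [abs_mul, hε1, one_mul]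
  have hmeas : ∀ r, Measurable fun y => g (bernoulliCgf (h y) (ε y * r)) := fun r =>
    hgd.continuous.measurable.comp (measurable_bernoulliCgf_comp hh hε r)
  have hint : Integrable (fun y => g (bernoulliCgf (h y) (ε y * s))) := by
    refine (((hhi.const_mul (Real.exp (2 * |s|))).const_mul |s|).const_mul
      (deriv g |s|)).mono' (hmeas s).aestronglyMeasurable (Filter.Eventually.of_forall fun y => ?_)
    have hle := abs_bernoulliCgf_le_abs (h0 y) (h1 y) (ε y * s)
    rw [habs] at hle
    exact (abs_le_mul_abs_of_tangent_le hg hg' hzero hle).trans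
      (mul_le_mul_of_nonneg_left (abs_bernoulliCgf_le (h0 y) (h1 y) (habs y s).le) (hg' _))
  refine ⟨hint, ?_⟩
  refine hasDerivAt_integral_of_dominated_loc_of_deriv_le
    (F' := fun r y => deriv g (bernoulliCgf (h y) (ε y * r)) *
      (bernoulliTilt (h y) (ε y * r) * ε y))
    (bound := fun y => deriv g (|s| + 1) * (Real.exp (2 * (|s| + 1)) * h y))
    (Metric.ball_mem_nhds s one_pos)
    (Filter.Eventually.of_forall fun r => (hmeas r).aestronglyMeasurable) hint ?_ ?_
    ((hhi.const_mul _).const_mul _) ?_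
  · exact (((measurable_deriv g).comp (measurable_bernoulliCgf_comp hh hε s)).mul
      ((measurable_bernoulliTilt_comp hh hε s).mul hε)).aestronglyMeasurable
  · refine Filter.Eventually.of_forall fun y r hr => ?_
    have hrs : |r| ≤ |s| + 1 := by
      have := abs_sub_abs_le_abs_sub r s
      rw [Metric.mem_ball, Real.dist_eq] at hr
      linarith
    have hyr : |ε y * r| ≤ |s| + 1 := (habs y r).le.trans hrs
    rw [norm_mul, norm_mul, Real.norm_eq_abs, Real.norm_eq_abs, Real.norm_eq_abs, hε1, mul_one,
      abs_of_nonneg (hg' _), abs_of_pos (bernoulliTilt_pos (h0 y) (h1 y) _)]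
    exact mul_le_mul
      (hmono ((le_abs_self _).trans ((abs_bernoulliCgf_le_abs (h0 y) (h1 y) _).trans hyr)))
      (bernoulliTilt_le (h0 y) (h1 y) hyr) (bernoulliTilt_pos (h0 y) (h1 y) _).le (hg' _)
  · refine Filter.Eventually.of_forall fun y r _ => ?_
    have hlin : HasDerivAt (fun r => ε y * r) (ε y) r := by
      simpa using (hasDerivAt_id r).const_mul (ε y)
    exact (hgd _).hasDerivAt.comp r ((hasDerivAt_bernoulliCgf (h0 y) (h1 y) _).comp r hlin)

/-- The Legendre dual of `Λ s = ∫ g (bernoulliCgf (h y) (ε y * s)) dy` along the range of its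
derivative. -/
theorem dual_integral_bernoulliCgf_comp (hgd : Differentiable ℝ g)
    (hg : ∀ s r, g s + deriv g s * (r - s) ≤ g r) (hg' : ∀ s, 0 ≤ deriv g s) (hzero : g 0 = 0)
    (hh : Measurable h) (h0 : ∀ y, 0 < h y) (h1 : ∀ y, h y < 1) (hhi : Integrable h)
    (hε : Measurable ε) (hε1 : ∀ y, |ε y| = 1) {Λ : ℝ → ℝ}
    (hΛ : ∀ s, Λ s = ∫ y, g (bernoulliCgf (h y) (ε y * s))) (s : ℝ) :
    (s * deriv Λ s - Λ s =
      (∫ y, (bernoulliCgf (h y) (ε y * s) * deriv g (bernoulliCgf (h y) (ε y * s)) -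
        g (bernoulliCgf (h y) (ε y * s)))) +
      ∫ y, deriv g (bernoulliCgf (h y) (ε y * s)) *
        (ε y * s * bernoulliTilt (h y) (ε y * s) - bernoulliCgf (h y) (ε y * s))) ∧
    ∀ r, Λ s + deriv Λ s * (r - s) ≤ Λ r := by
  obtain ⟨hint, hint', hder⟩ :=
    hasDerivAt_integral_bernoulliCgf_comp hgd hg hg' hzero hh h0 h1 hhi hε hε1 s
  obtain rfl : Λ = fun s => ∫ y, g (bernoulliCgf (h y) (ε y * s)) := funext hΛ
  rw [hder.deriv]
  have hL : Integrable fun y =>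
      bernoulliCgf (h y) (ε y * s) * deriv g (bernoulliCgf (h y) (ε y * s)) := by
    refine (((hhi.const_mul (Real.exp (2 * |s|))).const_mul |s|).mul_const
      (deriv g |s|)).mono' ((measurable_bernoulliCgf_comp hh hε s).mul
        ((measurable_deriv g).comp (measurable_bernoulliCgf_comp hh hε s))).aestronglyMeasurable
      (Filter.Eventually.of_forall fun y => ?_)
    have hys : |ε y * s| ≤ |s| := by rw [abs_mul, hε1, one_mul]
    rw [norm_mul, Real.norm_eq_abs, Real.norm_eq_abs, abs_of_nonneg (hg' _)]
    have hb := abs_bernoulliCgf_le (h0 y) (h1 y) hys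
    exact mul_le_mul hb (monotone_deriv_of_tangent_le hg ((le_abs_self _).trans
      ((abs_bernoulliCgf_le_abs (h0 y) (h1 y) _).trans hys))) (hg' _) ((abs_nonneg _).trans hb)
  constructor
  · rw [← integral_const_mul, ← integral_sub (hint'.const_mul s) hint, ← integral_add]
    · refine integral_congr_ae (Filter.Eventually.of_forall fun y => ?_)
      simp only
      ring
    · exact hL.sub hint
    · refine ((hint'.const_mul s).sub hL).congr (Filter.Eventually.of_forall fun y => ?_)
      simp only [Pi.sub_apply]
      ring
  · intro r
    obtain ⟨hintr, -, -⟩ :=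
      hasDerivAt_integral_bernoulliCgf_comp hgd hg hg' hzero hh h0 h1 hhi hε hε1 r
    simp only
    rw [← integral_mul_const, ← integral_add hint (hint'.mul_const _)]
    refine integral_mono (hint.add (hint'.mul_const _)) hintr fun y => ?_
    have ha := hg (bernoulliCgf (h y) (ε y * s)) (bernoulliCgf (h y) (ε y * r))
    have hb := mul_le_mul_of_nonneg_left
      (bernoulliCgf_add_le (h0 y) (h1 y) (ε y * s) (ε y * r))
      (hg' (bernoulliCgf (h y) (ε y * s)))
    simp only
    linarith

end Integral

section Gaussian

variable {s : ℝ}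

lemma gphi_eq_gaussianPDFReal (hs : 0 < s) :
    gphi s = ProbabilityTheory.gaussianPDFReal 0 ⟨s, hs.le⟩ := by
  ext x
  simp only [gphi, ProbabilityTheory.gaussianPDFReal, sub_zero]
  rfl

lemma integrable_gphi_s17 (hs : 0 < s) : Integrable (gphi s) := by
  rw [gphi_eq_gaussianPDFReal hs]
  exact ProbabilityTheory.integrable_gaussianPDFReal _ _

lemma integral_gphi (hs : 0 < s) : ∫ x, gphi s x = 1 := by
  rw [gphi_eq_gaussianPDFReal hs]
  exact ProbabilityTheory.integral_gaussianPDFReal_eq_one _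
    (fun h => hs.ne' (congrArg NNReal.toReal h))

lemma gphi_pos (hs : 0 < s) (x : ℝ) : 0 < gphi s x := by
  have : 0 < 2 * Real.pi * s := by positivity
  unfold gphi
  positivity

lemma gphi_neg (s x : ℝ) : gphi s (-x) = gphi s x := by simp [gphi]

lemma one_sub_gPhi (hs : 0 < s) (y : ℝ) : 1 - gPhi s y = gPhi s (-y) := by
  have h1 : gPhi s y + ∫ x in Set.Ioi y, gphi s x = 1 := by
    rw [gPhi, ← integral_gphi hs, ← Set.compl_Iic]
    exact integral_add_compl measurableSet_Iic (integrable_gphi_s17 hs)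
  have h2 : gPhi s (-y) = ∫ x in Set.Ioi y, gphi s x := by
    rw [gPhi, ← integral_comp_neg_Ioi]
    simp only [gphi_neg]
  linarith

lemma gPhi_pos (hs : 0 < s) (y : ℝ) : 0 < gPhi s y := by
  rw [gPhi, setIntegral_pos_iff_support_of_nonneg_ae
    (Filter.Eventually.of_forall fun x => (gphi_pos hs x).le) (integrable_gphi_s17 hs).integrableOn]
  have : Function.support (gphi s) = Set.univ :=
    Set.eq_univ_of_forall fun x => (gphi_pos hs x).ne'
  simp [this]

lemma gPhi_lt_one (hs : 0 < s) (y : ℝ) : gPhi s y < 1 := by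
  have := one_sub_gPhi hs y
  have := gPhi_pos hs (-y)
  linarith

lemma monotone_gPhi (hs : 0 < s) : Monotone (gPhi s) := fun _ _ hab =>
  setIntegral_mono_set (integrable_gphi_s17 hs).integrableOn
    (Filter.Eventually.of_forall fun x => (gphi_pos hs x).le)
    (Set.Iic_subset_Iic.2 hab).eventuallyLE

lemma gPhi_le_exp (hs : 0 < s) (y : ℝ) :
    gPhi s y ≤ (Real.sqrt (2 * Real.pi * s))⁻¹ * Real.exp (s / 2) * Real.exp y := by
  rw [← integral_exp_Iic y, ← integral_const_mul, gPhi]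
  refine setIntegral_mono (integrable_gphi_s17 hs).integrableOn
    ((integrableOn_exp_Iic y).const_mul _) fun x => ?_
  rw [gphi, mul_assoc (Real.sqrt _)⁻¹, ← Real.exp_add]
  refine mul_le_mul_of_nonneg_left (Real.exp_le_exp.2 ?_) (by positivity)
  rw [div_le_iff₀ (by positivity)]
  nlinarith [sq_nonneg (x + s)]

/-- The smaller of the two Gaussian tails cut off at `y`, written on the side of `y`. -/
noncomputable def gaussianTail (s y : ℝ) : ℝ := if 0 < y then 1 - gPhi s y else gPhi s y

lemma gaussianTail_eq (hs : 0 < s) (y : ℝ) : gaussianTail s y = gPhi s (-|y|) := by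
  unfold gaussianTail
  split_ifs with hy
  · rw [one_sub_gPhi hs, abs_of_pos hy]
  · rw [abs_of_nonpos (not_lt.1 hy), neg_neg]

lemma measurable_gaussianTail (hs : 0 < s) : Measurable (gaussianTail s) := by
  rw [funext (gaussianTail_eq hs)]
  exact (monotone_gPhi hs).measurable.comp (by fun_prop)

lemma integrable_gaussianTail (hs : 0 < s) : Integrable (gaussianTail s) := by
  have hexp : Integrable fun y : ℝ => Real.exp (-|y|) := by
    rw [← integrableOn_univ, ← Set.Iic_union_Ioi (a := (0 : ℝ)), integrableOn_union]
    constructor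
    · refine (integrableOn_exp_Iic 0).congr_fun (fun y hy => ?_) measurableSet_Iic
      simp [abs_of_nonpos (Set.mem_Iic.1 hy)]
    · refine (integrableOn_exp_neg_Ioi 0).congr_fun (fun y hy => ?_) measurableSet_Ioi
      simp [abs_of_pos (Set.mem_Ioi.1 hy)]
  refine (hexp.const_mul ((Real.sqrt (2 * Real.pi * s))⁻¹ * Real.exp (s / 2))).mono'
    (measurable_gaussianTail hs).aestronglyMeasurable (Filter.Eventually.of_forall fun y => ?_)
  rw [gaussianTail_eq hs, Real.norm_of_nonneg (gPhi_pos hs _).le]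
  exact gPhi_le_exp hs _

end Gaussian

/-- decomposition of the convex dual of `Λ` along the range of `Λ′` into the
two cost integrals `I₁` and `I₂`:
`α·Λ′(α) − Λ(α) = ∫ γ*(γ′(Z_α(y))) dy + ∫ γ′(Z_α(y))·Br*_{Φ(y)}(F_α(y)) dy`, and
equivalently `Λ*(Λ′(α))` equals the same right-hand side. -/
theorem dual_decomposition (t κ₂ : ℝ) (ht : 0 < t) (hκ : 0 < κ₂)
    (Ω : Type) [MeasureSpace Ω] [IsProbabilityMeasure (volume : Measure Ω)]
    (η : Ω → ℝ) (hmeas : Measurable η) (hnonneg : ∀ ω, 0 ≤ η ω)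
    (hpos : 0 < volume {ω | 0 < η ω})
    (hint : ∀ θ : ℝ, Integrable (fun ω => Real.exp (θ * η ω)) volume)
    (γ : ℝ → ℝ) (hγ : ∀ θ, γ θ = Real.log (∫ ω, Real.exp (θ * η ω)))
    (Z : ℝ → ℝ → ℝ)
    (hZ : ∀ lam y, Z lam y =
      if 0 < y then Real.log (gPhi (κ₂ * t) y + Real.exp lam * (1 - gPhi (κ₂ * t) y))
      else Real.log (Real.exp (-lam) * gPhi (κ₂ * t) y + (1 - gPhi (κ₂ * t) y)))
    (Λ : ℝ → ℝ) (hΛ : ∀ lam, Λ lam = ∫ y : ℝ, γ (Z lam y))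
    (F : ℝ → ℝ → ℝ)
    (hF : ∀ α y, F α y = Real.exp (-α) * gPhi (κ₂ * t) y /
      (1 - gPhi (κ₂ * t) y + Real.exp (-α) * gPhi (κ₂ * t) y))
    (γs : ℝ → ℝ) (hγs : ∀ u, γs u = ⨆ θ : ℝ, (θ * u - γ θ))
    (Brs : ℝ → ℝ → ℝ)
    (hBrs : ∀ p u, Brs p u = u * Real.log (u / p) + (1 - u) * Real.log ((1 - u) / (1 - p))) :
    ∀ α : ℝ,
      (α * deriv Λ α - Λ α =
        (∫ y : ℝ, γs (deriv γ (Z α y)))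
          + ∫ y : ℝ, deriv γ (Z α y) * Brs (gPhi (κ₂ * t) y) (F α y)) ∧
      ((⨆ lam : ℝ, (deriv Λ α * lam - Λ lam)) =
        (∫ y : ℝ, γs (deriv γ (Z α y)))
          + ∫ y : ℝ, deriv γ (Z α y) * Brs (gPhi (κ₂ * t) y) (F α y)) := by
  have hs : 0 < κ₂ * t := mul_pos hκ ht
  have hγc : γ = ProbabilityTheory.cgf η volume := funext hγ
  have hgd : Differentiable ℝ γ := hγc ▸ differentiable_cgf_of_forall hint
  have hg : ∀ s r, γ s + deriv γ s * (r - s) ≤ γ r := hγc ▸ cgf_add_deriv_mul_le hint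
  have hg' : ∀ s, 0 ≤ deriv γ s := hγc ▸ deriv_cgf_nonneg hint hnonneg
  have hzero : γ 0 = 0 := hγc ▸ ProbabilityTheory.cgf_zero
  set h : ℝ → ℝ := gaussianTail (κ₂ * t) with hh
  set ε : ℝ → ℝ := fun y => if 0 < y then 1 else -1 with hεdef
  have h0 : ∀ y, 0 < h y := fun y => by
    rw [hh, gaussianTail_eq hs]
    exact gPhi_pos hs _
  have h1 : ∀ y, h y < 1 := fun y => by
    rw [hh, gaussianTail_eq hs]
    exact gPhi_lt_one hs _
  have hε : Measurable ε :=
    Measurable.ite measurableSet_Ioi measurable_const measurable_const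
  have hε1 : ∀ y, |ε y| = 1 := fun y => by
    simp only [hεdef]
    split_ifs <;> simp
  have hZL : ∀ lam y, Z lam y = bernoulliCgf (h y) (ε y * lam) := fun lam y => by
    rw [hZ]
    simp only [hh, hεdef, gaussianTail, bernoulliCgf]
    split_ifs
    · rw [one_mul, sub_sub_cancel]
    · rw [neg_one_mul, add_comm]
  have hBr : ∀ α y, Brs (gPhi (κ₂ * t) y) (F α y) =
      ε y * α * bernoulliTilt (h y) (ε y * α) - bernoulliCgf (h y) (ε y * α) := fun α y => by
    rw [← bernoulli_relative_entropy_tilt (h0 y) (h1 y), hBrs]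
    have hF' : F α y = bernoulliTilt (gPhi (κ₂ * t) y) (-α) := hF α y
    by_cases hy : 0 < y
    · have hF1 : F α y = 1 - bernoulliTilt (h y) (ε y * α) := by
        rw [one_sub_bernoulliTilt (h0 y) (h1 y), hF]
        simp only [hh, hεdef, gaussianTail, if_pos hy, one_mul, sub_sub_cancel, Real.exp_neg]
        have hp := gPhi_pos hs y
        have hq := gPhi_lt_one hs y
        have := Real.exp_pos α
        have hd1 : 0 < gPhi (κ₂ * t) y + Real.exp α * (1 - gPhi (κ₂ * t) y) :=
          add_pos hp (mul_pos this (by linarith))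
        have hd2 : 0 < 1 - gPhi (κ₂ * t) y + (Real.exp α)⁻¹ * gPhi (κ₂ * t) y :=
          add_pos (by linarith) (by positivity)
        rw [div_eq_div_iff hd2.ne' hd1.ne']
        field_simp
        ring
      have hhy : h y = 1 - gPhi (κ₂ * t) y := by simp only [hh, gaussianTail, if_pos hy]
      rw [hF1, hhy]
      simp only [sub_sub_cancel]
      ring
    · have hhy : h y = gPhi (κ₂ * t) y := by simp only [hh, gaussianTail, if_neg hy]
      have hεy : ε y = -1 := by simp only [hεdef, if_neg hy]
      rw [hF', hhy, hεy, neg_one_mul]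
  have hconj : ∀ z, γs (deriv γ z) = z * deriv γ z - γ z := fun z => by
    rw [hγs]
    exact iSup_mul_sub_eq_of_tangent_le (hg z)
  intro α
  have hΛL : ∀ lam, Λ lam = ∫ y, γ (bernoulliCgf (h y) (ε y * lam)) := fun lam => by
    simp only [hΛ, hZL]
  obtain ⟨hdual, htan⟩ := dual_integral_bernoulliCgf_comp hgd hg hg' hzero
    (measurable_gaussianTail hs) h0 h1 (integrable_gaussianTail hs) hε hε1 hΛL α
  simp only [hconj, hBr, hZL]
  refine ⟨hdual, ?_⟩
  rw [← hdual, ← iSup_mul_sub_eq_of_tangent_le htan]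
  simp only [mul_comm]
end

section
/- (Convex dual of a composition.) Let f, g : ℝ → ℝ be differentiable functions with f convex and nondecreasing and g convex. Fix λ ∈ ℝ and set x = f′(g(λ))·g′(λ). Then (f∘g)*(x) = f′(g(λ))·g*(g′(λ)) + f*(f′(g(λ))), where h*(y) = sup_{μ∈ℝ}(yμ − h(μ)) denotes the convex dual. -/
open Real

/-- The convex dual (Legendre transform) of `h`, with values in `(−∞, ∞]` (as `EReal`). -/
noncomputable def edual (h : ℝ → ℝ) (y : ℝ) : EReal :=
  ⨆ μ : ℝ, ((y * μ - h μ : ℝ) : EReal)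

/-- A differentiable convex function lies above its tangent lines. -/
theorem ConvexOn.tangent_le {h : ℝ → ℝ} (hc : ConvexOn ℝ Set.univ h)
    (hd : Differentiable ℝ h) (a μ : ℝ) : deriv h a * (μ - a) ≤ h μ - h a := by
  rcases lt_trichotomy a μ with hlt | rfl | hlt
  · have := hc.deriv_le_slope (Set.mem_univ a) (Set.mem_univ μ) hlt (hd a)
    rwa [slope_def_field, le_div_iff₀ (sub_pos.2 hlt)] at this
  · simp
  · have := hc.slope_le_deriv (Set.mem_univ μ) (Set.mem_univ a) hlt (hd a)
    rw [slope_def_field, div_le_iff₀ (sub_pos.2 hlt)] at this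
    linarith

/-- The supremum defining the dual is attained at the point of tangency of a supporting line. -/
theorem edual_eq_of_supporting_line {h : ℝ → ℝ} {a y : ℝ}
    (hy : ∀ μ, y * (μ - a) ≤ h μ - h a) : edual h y = ((y * a - h a : ℝ) : EReal) := by
  refine le_antisymm (iSup_le fun μ => EReal.coe_le_coe_iff.2 ?_)
    (le_iSup (fun μ : ℝ => ((y * μ - h μ : ℝ) : EReal)) a)
  linarith [hy μ]

/-- convex dual of a composition: if `f` is convex nondecreasing and `g` is
convex, both differentiable, and `x = f′(g(λ))·g′(λ)`, then
`(f∘g)*(x) = f′(g(λ))·g*(g′(λ)) + f*(f′(g(λ)))`. -/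
theorem dual_of_composition (f g : ℝ → ℝ)
    (hfd : Differentiable ℝ f) (hgd : Differentiable ℝ g)
    (hfc : ConvexOn ℝ Set.univ f) (hfm : Monotone f) (hgc : ConvexOn ℝ Set.univ g)
    (lam x : ℝ) (hx : x = deriv f (g lam) * deriv g lam) :
    edual (f ∘ g) x
      = ((deriv f (g lam) : ℝ) : EReal) * edual g (deriv g lam) + edual f (deriv f (g lam)) := by
  have hf := hfc.tangent_le hfd (g lam)
  have hg := hgc.tangent_le hgd lam
  have hfg : ∀ μ, x * (μ - lam) ≤ (f ∘ g) μ - (f ∘ g) lam := fun μ => by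
    rw [hx, mul_assoc]
    exact (mul_le_mul_of_nonneg_left (hg μ) hfm.deriv_nonneg).trans (hf (g μ))
  rw [edual_eq_of_supporting_line hf, edual_eq_of_supporting_line hg,
    edual_eq_of_supporting_line hfg, ← EReal.coe_mul, ← EReal.coe_add, EReal.coe_eq_coe_iff, hx,
    Function.comp_apply]
  ring
end
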